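/- Let q ∈ M be a point with θ(q) = 0, and suppose either that 0 < |t(q)| < t₀ and φ(m(t(q))) ≥ π, or that |t(q)| ≥ t₀. Then the cut locus of q is exactly the meridian opposite to q: C_q = θ⁻¹(π). -/

import Mathlib

open Real Set

noncomputable section

/-- Length of a C¹ curve `c` on `[a,b]` in the warped product metric
`ds² = dt² + m(t)² dθ²` on `M̃ = ℝ²` (coordinates `(t,θ)`). -/
def wLength (m : ℝ → ℝ) (c : ℝ → ℝ × ℝ) (a b : ℝ) : ℝ :=
  ∫ s in a..b,
    Real.sqrt ((deriv (fun u => (c u).1) s) ^ 2 +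
      (m (c s).1) ^ 2 * (deriv (fun u => (c u).2) s) ^ 2)

/-- The Riemannian distance on `M̃`: the infimum of lengths of C¹ curves joining `p` to `q`. -/
def wDist (m : ℝ → ℝ) (p q : ℝ × ℝ) : ℝ :=
  sInf {L : ℝ | ∃ c : ℝ → ℝ × ℝ, ∃ b : ℝ, 0 ≤ b ∧ ContDiff ℝ 1 c ∧
    c 0 = p ∧ c b = q ∧ L = wLength m c 0 b}

/-- `γ = (t(s), θ(s))` is a unit-speed geodesic of the warped product metric:
`t'' = m(t) m'(t) θ'²`, `m(t)² θ'` is constant, and `t'² + m(t)² θ'² = 1`. -/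
def IsUnitGeodesic (m : ℝ → ℝ) (γ : ℝ → ℝ × ℝ) : Prop :=
  ContDiff ℝ 2 γ ∧
  (∀ s, deriv (deriv fun u => (γ u).1) s =
      m (γ s).1 * deriv m (γ s).1 * (deriv (fun u => (γ u).2) s) ^ 2) ∧
  (∃ ν : ℝ, ∀ s, m (γ s).1 ^ 2 * deriv (fun u => (γ u).2) s = ν) ∧
  (∀ s, (deriv (fun u => (γ u).1) s) ^ 2 +
      m (γ s).1 ^ 2 * (deriv (fun u => (γ u).2) s) ^ 2 = 1)

/-- `ν` is the Clairaut constant of the geodesic `γ`: `m(t(s))² θ'(s) = ν` for all `s`. -/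
def HasClairaut (m : ℝ → ℝ) (γ : ℝ → ℝ × ℝ) (ν : ℝ) : Prop :=
  ∀ s, m (γ s).1 ^ 2 * deriv (fun u => (γ u).2) s = ν

/-- The (unit-speed) geodesic segment `γ|[0,a]` is minimal: its length `a` equals
the distance between its endpoints. -/
def IsMinimalSeg (m : ℝ → ℝ) (γ : ℝ → ℝ × ℝ) (a : ℝ) : Prop :=
  wDist m (γ 0) (γ a) = a

/-- `x` is a cut point of `p`: the endpoint of some minimal geodesic segment from `p`
no extension of which is minimal. -/
def IsCutPoint (m : ℝ → ℝ) (p x : ℝ × ℝ) : Prop :=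
  ∃ γ : ℝ → ℝ × ℝ, ∃ a : ℝ, IsUnitGeodesic m γ ∧ γ 0 = p ∧ 0 < a ∧ γ a = x ∧
    IsMinimalSeg m γ a ∧ ∀ ε > 0, ¬ IsMinimalSeg m γ (a + ε)

/-- The cut locus of `p` in `M̃`. -/
def cutLocus (m : ℝ → ℝ) (p : ℝ × ℝ) : Set (ℝ × ℝ) := {x | IsCutPoint m p x}

/-- The Gaussian curvature `K(t) = -m''(t)/m(t)` of the warped product metric. -/
def gaussK (m : ℝ → ℝ) (t : ℝ) : ℝ := -(deriv (deriv m) t) / m t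

/-- `ξ(ν) := min {t > 0 | m t = ν}`. -/
def xi (m : ℝ → ℝ) (ν : ℝ) : ℝ := sInf {t : ℝ | 0 < t ∧ m t = ν}

/-- `φ(ν) := 2∫₀^{ξ(ν)} ν / (m(t) √(m(t)² - ν²)) dt`. -/
def phi (m : ℝ → ℝ) (ν : ℝ) : ℝ :=
  2 * ∫ t in (0:ℝ)..(xi m ν), ν / (m t * Real.sqrt ((m t) ^ 2 - ν ^ 2))

/-- `l(ν) := 2∫_{-ξ(ν)}^{0} m(t) / √(m(t)² - ν²) dt`. -/
def ell (m : ℝ → ℝ) (ν : ℝ) : ℝ :=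
  2 * ∫ t in (-(xi m ν))..(0:ℝ), m t / Real.sqrt ((m t) ^ 2 - ν ^ 2)

/-- `inf m`. -/
def infm (m : ℝ → ℝ) : ℝ := ⨅ t : ℝ, m t

/-- `t₀ := sup {t > 0 | m'(t) < 0}`. -/
def tZero (m : ℝ → ℝ) : ℝ := sSup {t : ℝ | 0 < t ∧ deriv m t < 0}

/-- The covering projection from `M̃ = ℝ²` to the cylinder `M = ℝ × S¹`,
where the angular coordinate is taken modulo `2π`. -/
def proj (p : ℝ × ℝ) : ℝ × Real.Angle := (p.1, (p.2 : Real.Angle))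

/-- The Riemannian distance on the cylinder `M`: the infimum of lengths of curves
joining the two points, computed via lifts to `M̃`. -/
def cylDist (m : ℝ → ℝ) (P Q : ℝ × Real.Angle) : ℝ :=
  sInf {L : ℝ | ∃ p q : ℝ × ℝ, proj p = P ∧ proj q = Q ∧ L = wDist m p q}

/-- A unit-speed geodesic of the cylinder `M` is the projection of a unit-speed
geodesic of `M̃`. -/
def IsCylGeodesic (m : ℝ → ℝ) (γ : ℝ → ℝ × Real.Angle) : Prop :=
  ∃ γ' : ℝ → ℝ × ℝ, IsUnitGeodesic m γ' ∧ γ = fun s => proj (γ' s)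

/-- The (unit-speed) geodesic segment `γ|[0,a]` in `M` is minimal. -/
def IsCylMinimalSeg (m : ℝ → ℝ) (γ : ℝ → ℝ × Real.Angle) (a : ℝ) : Prop :=
  cylDist m (γ 0) (γ a) = a

/-- The cut locus of the point `P` on the cylinder `M`. -/
def cylCutLocus (m : ℝ → ℝ) (P : ℝ × Real.Angle) : Set (ℝ × Real.Angle) :=
  {X | ∃ γ : ℝ → ℝ × Real.Angle, ∃ a : ℝ, IsCylGeodesic m γ ∧ γ 0 = P ∧ 0 < a ∧ γ a = X ∧
    IsCylMinimalSeg m γ a ∧ ∀ ε > 0, ¬ IsCylMinimalSeg m γ (a + ε)}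

section
open Real Set

/-- The weight comparing the metric with a round sphere of radius `m 0`. -/
def wgt (m : ℝ → ℝ) (t : ℝ) : ℝ := -deriv m t / Real.sqrt (m 0 ^ 2 - m t ^ 2)

/-- The qualitative shape of the warping function used in the proof. -/
structure MH (m : ℝ → ℝ) (t0 : ℝ) : Prop where
  cd : ContDiff ℝ 2 m
  pos : ∀ t, 0 < m t
  even : ∀ t, m (-t) = m t
  t0pos : 0 < t0
  dneg : ∀ t, 0 < t → t < t0 → deriv m t < 0
  dzero : deriv m t0 = 0
  dpos : ∀ t, t0 < t → 0 < deriv m t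
  dmono : MonotoneOn (deriv m) (Ici t0)
  wanti : ∀ s t, 0 < s → s ≤ t → t < t0 → wgt m t ≤ wgt m s

namespace MH
variable {m : ℝ → ℝ} {t0 : ℝ}

theorem diff (h : MH m t0) : Differentiable ℝ m := h.cd.differentiable (by norm_num)

theorem hd (h : MH m t0) (t : ℝ) : HasDerivAt m (deriv m t) t := (h.diff t).hasDerivAt

theorem cont (h : MH m t0) : Continuous m := h.cd.continuous

theorem cdd (h : MH m t0) : ContDiff ℝ 1 (deriv m) := by
  have := h.cd
  rw [show (2 : WithTop ℕ∞) = 1 + 1 by norm_num, contDiff_succ_iff_deriv] at this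
  exact this.2.2

theorem contd (h : MH m t0) : Continuous (deriv m) := h.cdd.continuous

theorem abs_eq (h : MH m t0) (t : ℝ) : m |t| = m t := by
  rcases abs_choice t with e | e <;> rw [e]
  exact h.even t

theorem anti (h : MH m t0) : StrictAntiOn m (Icc 0 t0) := by
  apply strictAntiOn_of_deriv_neg (convex_Icc 0 t0) h.cont.continuousOn
  intro x hx
  rw [interior_Icc] at hx
  exact h.dneg x hx.1 hx.2

theorem mono (h : MH m t0) : StrictMonoOn m (Ici t0) := by
  apply strictMonoOn_of_deriv_pos (convex_Ici t0) h.cont.continuousOn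
  intro x hx
  rw [interior_Ici] at hx
  exact h.dpos x hx

theorem le_of_abs (h : MH m t0) {t u : ℝ} (h1 : |t| ≤ |u|) (h2 : |u| ≤ t0) : m u ≤ m t := by
  rw [← h.abs_eq t, ← h.abs_eq u]
  exact h.anti.antitoneOn ⟨abs_nonneg _, h1.trans h2⟩ ⟨abs_nonneg _, h2⟩ h1

theorem lt_of_abs (h : MH m t0) {t u : ℝ} (h1 : |t| < |u|) (h2 : |u| ≤ t0) : m u < m t := by
  rw [← h.abs_eq t, ← h.abs_eq u]
  exact h.anti ⟨abs_nonneg _, h1.le.trans h2⟩ ⟨abs_nonneg _, h2⟩ h1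

theorem min_le (h : MH m t0) (t : ℝ) : m t0 ≤ m t := by
  rcases le_total |t| t0 with h1 | h1
  · have h0 := abs_of_pos h.t0pos
    exact h.le_of_abs (by rw [h0]; exact h1) h0.le
  · rw [← h.abs_eq t]
    exact h.mono.monotoneOn self_mem_Ici h1 h1

theorem lt_zero (h : MH m t0) : m t0 < m 0 :=
  h.anti ⟨le_rfl, h.t0pos.le⟩ ⟨h.t0pos.le, le_rfl⟩ h.t0pos

end MH

theorem deriv_zero_of_even {m : ℝ → ℝ} (hd : Differentiable ℝ m) (he : ∀ t, m (-t) = m t) :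
    deriv m 0 = 0 := by
  have h1 : HasDerivAt m (deriv m 0) 0 := (hd 0).hasDerivAt
  have h2 : HasDerivAt (fun t => m (-t)) (deriv m (-0) * (-1)) 0 :=
    ((hd (-0)).hasDerivAt).comp 0 (hasDerivAt_neg 0)
  have h3 : (fun t => m (-t)) = m := funext he
  rw [h3] at h2
  have := h1.unique h2
  rw [neg_zero] at this
  linarith

theorem mh_of_hyp (m : ℝ → ℝ) (hm : ContDiff ℝ (⊤:ℕ∞) m) (hmpos : ∀ t, 0 < m t)
    (hmeven : ∀ t, m (-t) = m t)
    (hK0 : 0 < gaussK m 0) (hKdec : AntitoneOn (gaussK m) (Ici 0))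
    (hbdd : BddAbove {t : ℝ | 0 < t ∧ deriv m t < 0}) : MH m (tZero m) := by
  have cd : ContDiff ℝ 2 m := hm.of_le (by
    have h2 : ((2:ℕ∞) : WithTop ℕ∞) ≤ ((⊤:ℕ∞) : WithTop ℕ∞) := WithTop.coe_le_coe.2 le_top
    exact h2)
  have hdm : Differentiable ℝ m := cd.differentiable (by norm_num)
  have cd1 : ContDiff ℝ 1 (deriv m) := by
    have := cd
    rw [show (2 : WithTop ℕ∞) = 1 + 1 by norm_num, contDiff_succ_iff_deriv] at this
    exact this.2.2
  have hdm' : Differentiable ℝ (deriv m) := cd1.differentiable (by norm_num)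
  have c1 : Continuous (deriv m) := cd1.continuous
  have c2 : Continuous (deriv (deriv m)) := cd1.continuous_deriv (by norm_num)
  have hKm : ∀ t, deriv (deriv m) t = - gaussK m t * m t := by
    intro t
    have := (hmpos t).ne'
    unfold gaussK
    field_simp
  have d0 : deriv m 0 = 0 := deriv_zero_of_even hdm hmeven
  have dd0 : deriv (deriv m) 0 < 0 := by
    rw [hKm]; nlinarith [hmpos 0]
  -- initial decrease
  obtain ⟨δ, hδ, hδn⟩ : ∃ δ > 0, ∀ x, 0 < x → x < δ → deriv m x < 0 := by
    have hev : ∀ᶠ x in nhds (0:ℝ), deriv (deriv m) x < 0 :=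
      c2.continuousAt.eventually (gt_mem_nhds dd0)
    obtain ⟨δ, hδ, hb⟩ := Metric.eventually_nhds_iff.1 hev
    refine ⟨δ, hδ, fun x hx hxd => ?_⟩
    have : StrictAntiOn (deriv m) (Icc 0 x) := by
      apply strictAntiOn_of_deriv_neg (convex_Icc 0 x) c1.continuousOn
      intro y hy
      rw [interior_Icc] at hy
      apply hb
      rw [Real.dist_eq, sub_zero, abs_of_pos hy.1]
      exact hy.2.trans hxd
    have := this ⟨le_rfl, hx.le⟩ ⟨hx.le, le_rfl⟩ hx
    linarith
  set T := {t : ℝ | 0 < t ∧ deriv m t < 0} with hT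
  have hδT : δ / 2 ∈ T := ⟨by linarith, hδn _ (by linarith) (by linarith)⟩
  have t0pos : 0 < tZero m := lt_of_lt_of_le (by linarith : 0 < δ / 2) (le_csSup hbdd hδT)
  have hge : ∀ t, tZero m < t → 0 ≤ deriv m t := by
    intro t ht
    by_contra hc
    push Not at hc
    exact absurd (le_csSup hbdd (show t ∈ T from ⟨t0pos.trans ht, hc⟩)) (not_le.2 ht)
  -- convexity propagates
  have conv : ∀ a b, 0 < a → a < b → deriv m a < deriv m b →
      ∃ x, a < x ∧ x < b ∧ (∀ y, x ≤ y → gaussK m y < 0) ∧ StrictMonoOn (deriv m) (Ici x) := by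
    intro a b ha hab hlt
    obtain ⟨x, hx, hxe⟩ := exists_deriv_eq_slope (deriv m) hab c1.continuousOn
      hdm'.differentiableOn
    have hpos : 0 < deriv (deriv m) x := by
      rw [hxe]; apply div_pos <;> linarith
    have hKx : gaussK m x < 0 := by
      rw [hKm] at hpos
      by_contra hc
      push Not at hc
      nlinarith [hmpos x]
    have hKy : ∀ y, x ≤ y → gaussK m y < 0 := fun y hy =>
      lt_of_le_of_lt (hKdec (mem_Ici.2 (ha.trans hx.1).le)
        (mem_Ici.2 ((ha.trans hx.1).le.trans hy)) hy) hKx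
    refine ⟨x, hx.1, hx.2, hKy, ?_⟩
    apply strictMonoOn_of_deriv_pos (convex_Ici x) c1.continuousOn
    intro y hy
    rw [interior_Ici] at hy
    rw [hKm]
    have := hKy y (le_of_lt hy)
    nlinarith [hmpos y]
  have dneg : ∀ t, 0 < t → t < tZero m → deriv m t < 0 := by
    intro t ht htt
    by_contra hc
    push Not at hc
    obtain ⟨t2, ht2, htt2⟩ := exists_lt_of_lt_csSup ⟨_, hδT⟩ htt
    have hmin : 0 < min (δ/2) (t/2) := lt_min (by linarith) (by linarith)
    have hneg := hδn (min (δ/2) (t/2)) hmin (by have := min_le_left (δ/2) (t/2); linarith)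
    obtain ⟨x, hx1, hx2, -, hmono⟩ := conv (min (δ/2) (t/2)) t hmin
      (by have := min_le_right (δ/2) (t/2); linarith) (by linarith)
    have := hmono (mem_Ici.2 hx2.le) (mem_Ici.2 (hx2.le.trans htt2.le)) htt2
    have := ht2.2
    linarith
  have dzero : deriv m (tZero m) = 0 := by
    apply le_antisymm
    · have h1 : Filter.Tendsto (deriv m) (nhdsWithin (tZero m) (Iio (tZero m)))
          (nhds (deriv m (tZero m))) := c1.continuousAt.continuousWithinAt
      apply le_of_tendsto h1
      filter_upwards [Ioo_mem_nhdsLT t0pos] with x hx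
      exact (dneg x hx.1 hx.2).le
    · have h1 : Filter.Tendsto (deriv m) (nhdsWithin (tZero m) (Ioi (tZero m)))
          (nhds (deriv m (tZero m))) := c1.continuousAt.continuousWithinAt
      apply ge_of_tendsto h1
      filter_upwards [self_mem_nhdsWithin] with x hx
      exact hge x hx
  have h2 : tZero m / 2 < tZero m := by linarith
  obtain ⟨x, hx1, hx2, hK, hmono⟩ := conv (tZero m / 2) (tZero m) (by linarith) h2
    (by rw [dzero]; exact dneg _ (by linarith) h2)
  have m0gt : ∀ t, 0 < t → t < tZero m → m t < m 0 := by
    intro t ht htt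
    have : StrictAntiOn m (Icc 0 t) := by
      apply strictAntiOn_of_deriv_neg (convex_Icc 0 t) hdm.continuous.continuousOn
      intro y hy
      rw [interior_Icc] at hy
      exact dneg y hy.1 (hy.2.trans htt)
    exact this ⟨le_rfl, ht.le⟩ ⟨ht.le, le_rfl⟩ ht
  -- key inequality
  have key : ∀ t, 0 < t → t < tZero m →
      0 ≤ deriv m t ^ 2 - gaussK m t * (m 0 ^ 2 - m t ^ 2) := by
    intro t ht htt
    have hz : ∀ s, HasDerivAt (fun s => deriv m s ^ 2 - gaussK m t * (m 0 ^ 2 - m s ^ 2))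
        (2 * m s * deriv m s * (gaussK m t - gaussK m s)) s := by
      intro s
      have e1 := ((hdm' s).hasDerivAt.pow 2)
      have e2 := ((hdm s).hasDerivAt.pow 2)
      have e3 := e1.sub ((e2.const_sub (m 0 ^ 2)).const_mul (gaussK m t))
      refine e3.congr_deriv ?_
      rw [hKm]; simp; ring
    have hmon : MonotoneOn (fun s => deriv m s ^ 2 - gaussK m t * (m 0 ^ 2 - m s ^ 2))
        (Icc 0 t) := by
      apply monotoneOn_of_deriv_nonneg (convex_Icc 0 t)
      · exact fun s _ => (hz s).continuousAt.continuousWithinAt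
      · exact fun s _ => (hz s).differentiableAt.differentiableWithinAt
      · intro s hs
        rw [interior_Icc] at hs
        rw [(hz s).deriv]
        have a1 := dneg s hs.1 (hs.2.trans htt)
        have a2 := hKdec (mem_Ici.2 hs.1.le) (mem_Ici.2 ht.le) hs.2.le
        have a3 := hmpos s
        have : 0 ≤ (m s * -deriv m s) * (gaussK m s - gaussK m t) := by
          apply mul_nonneg (mul_nonneg a3.le (by linarith)) (by linarith)
        nlinarith
    have := hmon ⟨le_rfl, ht.le⟩ ⟨ht.le, le_rfl⟩ ht.le
    simp only [d0] at this
    linarith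
  have wsq : ∀ s t, 0 < s → s ≤ t → t < tZero m →
      deriv m t ^ 2 / (m 0 ^ 2 - m t ^ 2) ≤ deriv m s ^ 2 / (m 0 ^ 2 - m s ^ 2) := by
    intro s t hs hst htt
    have hq : ∀ y, 0 < y → y < tZero m → 0 < m 0 ^ 2 - m y ^ 2 := by
      intro y hy hyt
      have := m0gt y hy hyt
      have := hmpos y
      nlinarith
    have hz : ∀ y, 0 < y → y < tZero m →
        HasDerivAt (fun y => deriv m y ^ 2 / (m 0 ^ 2 - m y ^ 2))
        (2 * m y * deriv m y * (deriv m y ^ 2 - gaussK m y * (m 0 ^ 2 - m y ^ 2)) /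
          (m 0 ^ 2 - m y ^ 2) ^ 2) y := by
      intro y hy hyt
      have e1 := ((hdm' y).hasDerivAt.pow 2)
      have e2 := ((hdm y).hasDerivAt.pow 2).const_sub (m 0 ^ 2)
      have e3 := e1.div e2 (hq y hy hyt).ne'
      refine e3.congr_deriv ?_
      rw [hKm]; simp; ring
    have hmon : AntitoneOn (fun y => deriv m y ^ 2 / (m 0 ^ 2 - m y ^ 2)) (Icc s t) := by
      apply antitoneOn_of_deriv_nonpos (convex_Icc s t)
      · exact fun y hy => (hz y (hs.trans_le hy.1)
          (hy.2.trans_lt htt)).continuousAt.continuousWithinAt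
      · intro y hy
        rw [interior_Icc] at hy
        exact (hz y (hs.trans hy.1) (hy.2.trans htt)).differentiableAt.differentiableWithinAt
      · intro y hy
        rw [interior_Icc] at hy
        have y0 := hs.trans hy.1
        have y1 := hy.2.trans htt
        rw [(hz y y0 y1).deriv]
        apply div_nonpos_of_nonpos_of_nonneg _ (sq_nonneg _)
        have a1 := dneg y y0 y1
        have a2 := key y y0 y1
        have a3 := hmpos y
        have : 0 ≤ (m y * -deriv m y) *
            (deriv m y ^ 2 - gaussK m y * (m 0 ^ 2 - m y ^ 2)) :=
          mul_nonneg (mul_nonneg a3.le (by linarith)) a2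
        nlinarith
    exact hmon ⟨le_rfl, hst⟩ ⟨hst, le_rfl⟩ hst
  refine ⟨cd, hmpos, hmeven, t0pos, dneg, dzero, ?_, ?_, ?_⟩
  · intro t ht
    rw [← dzero]
    exact hmono (mem_Ici.2 hx2.le) (mem_Ici.2 (hx2.le.trans ht.le)) ht
  · exact hmono.monotoneOn.mono (Ici_subset_Ici.2 hx2.le)
  · intro s t hs hst htt
    have e : ∀ y, 0 < y → y < tZero m →
        wgt m y = Real.sqrt (deriv m y ^ 2 / (m 0 ^ 2 - m y ^ 2)) := by
      intro y hy hyt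
      rw [Real.sqrt_div (sq_nonneg _), Real.sqrt_sq_eq_abs, abs_of_neg (dneg y hy hyt)]
      rfl
    rw [e s hs (hst.trans_lt htt), e t (hs.trans_le hst) htt]
    exact Real.sqrt_le_sqrt (wsq s t hs hst htt)

end

section
open Real Set

/-- The speed of a curve. -/
def spd (m : ℝ → ℝ) (c : ℝ → ℝ × ℝ) (s : ℝ) : ℝ :=
  Real.sqrt ((deriv (fun u => (c u).1) s) ^ 2 +
      (m (c s).1) ^ 2 * (deriv (fun u => (c u).2) s) ^ 2)

theorem wLength_eq (m : ℝ → ℝ) (c : ℝ → ℝ × ℝ) (a b : ℝ) :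
    wLength m c a b = ∫ s in a..b, spd m c s := rfl

theorem spd_cont {m : ℝ → ℝ} (hm : Continuous m) {c : ℝ → ℝ × ℝ} (hc : ContDiff ℝ 1 c) :
    Continuous (spd m c) := by
  have h1 : ContDiff ℝ 1 (fun u => (c u).1) := hc.fst
  have h2 : ContDiff ℝ 1 (fun u => (c u).2) := hc.snd
  have e1 := h1.continuous_deriv (by norm_num)
  have e2 := h2.continuous_deriv (by norm_num)
  have e3 := h1.continuous
  unfold spd
  fun_prop

theorem spd_nonneg (m : ℝ → ℝ) (c : ℝ → ℝ × ℝ) (s : ℝ) : 0 ≤ spd m c s := Real.sqrt_nonneg _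

theorem wLength_nonneg (m : ℝ → ℝ) (c : ℝ → ℝ × ℝ) {b : ℝ} (hb : 0 ≤ b) :
    0 ≤ wLength m c 0 b :=
  intervalIntegral.integral_nonneg hb fun s _ => spd_nonneg m c s

theorem wDist_le {m : ℝ → ℝ} {p q : ℝ × ℝ} {c : ℝ → ℝ × ℝ} {b : ℝ} (hb : 0 ≤ b)
    (hc : ContDiff ℝ 1 c) (h0 : c 0 = p) (h1 : c b = q) : wDist m p q ≤ wLength m c 0 b := by
  apply csInf_le
  · refine ⟨0, ?_⟩
    rintro L ⟨c, b, hb, -, -, -, rfl⟩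
    exact wLength_nonneg m c hb
  · exact ⟨c, b, hb, hc, h0, h1, rfl⟩

theorem le_wDist {m : ℝ → ℝ} {p q : ℝ × ℝ} {L : ℝ}
    (h : ∀ (c : ℝ → ℝ × ℝ) (b : ℝ), 0 ≤ b → ContDiff ℝ 1 c → c 0 = p → c b = q →
      L ≤ wLength m c 0 b) : L ≤ wDist m p q := by
  apply le_csInf
  · refine ⟨_, fun s => p + s • (q - p), 1, zero_le_one, ?_, ?_, ?_, rfl⟩
    · fun_prop
    · simp
    · simp
  · rintro L' ⟨c, b, hb, hc, h0, h1, rfl⟩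
    exact h c b hb hc h0 h1

theorem wDist_nonneg (m : ℝ → ℝ) (p q : ℝ × ℝ) : 0 ≤ wDist m p q :=
  le_wDist fun c b hb _ _ _ => wLength_nonneg m c hb

theorem exists_curve {m : ℝ → ℝ} {p q : ℝ × ℝ} {ε : ℝ} (hε : 0 < ε) :
    ∃ (c : ℝ → ℝ × ℝ) (b : ℝ), 0 ≤ b ∧ ContDiff ℝ 1 c ∧ c 0 = p ∧ c b = q ∧
      wLength m c 0 b < wDist m p q + ε := by
  by_contra hc
  push Not at hc
  have := le_wDist (m := m) (p := p) (q := q) (L := wDist m p q + ε)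
    (fun c b hb h1 h2 h3 => hc c b hb h1 h2 h3)
  linarith

/-- Affine maps that do not expand the metric. -/
theorem wDist_map {m : ℝ → ℝ} (hm : Continuous m) (σ l k : ℝ) (hσ : σ ^ 2 = 1) (hl : l ^ 2 ≤ 1)
    (hms : ∀ t, m (σ * t) = m t) (p q : ℝ × ℝ) :
    wDist m (σ * p.1, l * p.2 + k) (σ * q.1, l * q.2 + k) ≤ wDist m p q := by
  apply le_wDist
  intro c b hb hc h0 h1
  have hc1 : ContDiff ℝ 1 (fun u => (c u).1) := hc.fst
  have hc2 : ContDiff ℝ 1 (fun u => (c u).2) := hc.snd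
  have hc' : ContDiff ℝ 1 (fun s => ((σ * (c s).1, l * (c s).2 + k) : ℝ × ℝ)) := by fun_prop
  refine (wDist_le (c := fun s => (σ * (c s).1, l * (c s).2 + k)) hb hc' (by simp [h0])
    (by simp [h1])).trans ?_
  rw [wLength_eq, wLength_eq]
  apply intervalIntegral.integral_mono_on hb
  · exact (spd_cont hm hc').intervalIntegrable _ _
  · exact (spd_cont hm hc).intervalIntegrable _ _
  · intro s _
    have d1 : deriv (fun u => σ * (c u).1) s = σ * deriv (fun u => (c u).1) s := by
      rw [deriv_const_mul_field]
    have d2 : deriv (fun u => l * (c u).2 + k) s = l * deriv (fun u => (c u).2) s := by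
      rw [deriv_add_const, deriv_const_mul_field]
    unfold spd
    apply Real.sqrt_le_sqrt
    simp only [d1, d2, hms]
    have : l ^ 2 * ((m (c s).1) ^ 2 * (deriv (fun u => (c u).2) s) ^ 2) ≤
        1 * ((m (c s).1) ^ 2 * (deriv (fun u => (c u).2) s) ^ 2) := by gcongr
    nlinarith

theorem smoothTransition_deriv_nonneg (s : ℝ) : 0 ≤ deriv Real.smoothTransition s :=
  Real.smoothTransition.monotone.deriv_nonneg

/-- Length of a reparametrised curve. -/
theorem wLength_reparam {m : ℝ → ℝ} (hm : Continuous m) {c : ℝ → ℝ × ℝ} (hc : ContDiff ℝ 1 c)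
    {b : ℝ} (hb : 0 ≤ b) (k : ℝ) {C : ℝ → ℝ × ℝ}
    (hC : ∀ s ∈ Ioo k (k + 1), C =ᶠ[nhds s] fun s => c (b * Real.smoothTransition (s - k))) :
    ∫ s in k..(k + 1), spd m C s = wLength m c 0 b := by
  set ρ : ℝ → ℝ := fun s => b * Real.smoothTransition (s - k) with hρ
  have hst : ContDiff ℝ 1 Real.smoothTransition := Real.smoothTransition.contDiff
  have hsd := hst.differentiable (by norm_num)
  have hρc : ContDiff ℝ 1 ρ := by
    have : ContDiff ℝ 1 (fun s => Real.smoothTransition (s - k)) :=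
      hst.comp (contDiff_id.sub contDiff_const)
    exact contDiff_const.mul this
  have hρd : ∀ s, HasDerivAt ρ (deriv ρ s) s := fun s =>
    (hρc.differentiable (by norm_num) s).hasDerivAt
  have hρ0 : ∀ s, 0 ≤ deriv ρ s := by
    intro s
    have : Monotone ρ := by
      intro x y hxy
      exact mul_le_mul_of_nonneg_left (Real.smoothTransition.monotone (by linarith)) hb
    exact this.deriv_nonneg
  have e0 : ρ k = 0 := by simp [hρ]
  have e1 : ρ (k + 1) = b := by simp [hρ]
  have key := intervalIntegral.integral_comp_mul_deriv (a := k) (b := k + 1) (f := ρ)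
    (f' := deriv ρ) (g := spd m c) (fun x _ => hρd x)
    (hρc.continuous_deriv (by norm_num)).continuousOn (spd_cont hm hc)
  rw [e0, e1] at key
  rw [wLength_eq, ← key]
  apply intervalIntegral.integral_congr_ae
  rw [MeasureTheory.ae_iff]
  have hsub : {s | ¬ (s ∈ uIoc k (k+1) → spd m C s = (spd m c ∘ ρ) s * deriv ρ s)} ⊆ {k+1} := by
    intro s hs
    simp only [mem_setOf_eq, Classical.not_imp] at hs
    obtain ⟨hs1, hs2⟩ := hs
    rw [uIoc_of_le (by linarith)] at hs1
    by_contra hne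
    apply hs2
    have hs3 : s ∈ Ioo k (k+1) := ⟨hs1.1, lt_of_le_of_ne hs1.2 hne⟩
    have hE := hC s hs3
    have hc1 : Differentiable ℝ (fun u => (c u).1) := hc.fst.differentiable (by norm_num)
    have hc2 : Differentiable ℝ (fun u => (c u).2) := hc.snd.differentiable (by norm_num)
    have d1 : deriv (fun u => (C u).1) s = deriv (fun u => (c u).1) (ρ s) * deriv ρ s := by
      have : (fun u => (C u).1) =ᶠ[nhds s] fun u => (c (ρ u)).1 := by
        filter_upwards [hE] with u hu
        rw [hu]
      rw [this.deriv_eq]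
      exact ((hc1 (ρ s)).hasDerivAt.comp s (hρd s)).deriv
    have d2 : deriv (fun u => (C u).2) s = deriv (fun u => (c u).2) (ρ s) * deriv ρ s := by
      have : (fun u => (C u).2) =ᶠ[nhds s] fun u => (c (ρ u)).2 := by
        filter_upwards [hE] with u hu
        rw [hu]
      rw [this.deriv_eq]
      exact ((hc2 (ρ s)).hasDerivAt.comp s (hρd s)).deriv
    have hCs : C s = c (ρ s) := hE.eq_of_nhds
    simp only [spd, Function.comp]
    rw [d1, d2, hCs]
    conv_rhs => rw [← Real.sqrt_sq (hρ0 s), ← Real.sqrt_mul (by positivity)]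
    congr 1
    ring
  exact MeasureTheory.measure_mono_null hsub (by simp)

theorem wDist_triangle {m : ℝ → ℝ} (hm : Continuous m) (p q r : ℝ × ℝ) :
    wDist m p r ≤ wDist m p q + wDist m q r := by
  apply le_of_forall_pos_le_add
  intro ε hε
  obtain ⟨c1, b1, hb1, hc1, h10, h11, hl1⟩ := exists_curve (m := m) (p := p) (q := q)
    (half_pos hε)
  obtain ⟨c2, b2, hb2, hc2, h20, h21, hl2⟩ := exists_curve (m := m) (p := q) (q := r)
    (half_pos hε)
  set C : ℝ → ℝ × ℝ := fun s => c1 (b1 * Real.smoothTransition (s - 0)) +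
    (c2 (b2 * Real.smoothTransition (s - 1)) - q) with hC
  have hst : ContDiff ℝ 1 Real.smoothTransition := Real.smoothTransition.contDiff
  have hCc : ContDiff ℝ 1 C := by
    have e : ∀ (c : ℝ → ℝ × ℝ) (b k : ℝ), ContDiff ℝ 1 c →
        ContDiff ℝ 1 (fun s => c (b * Real.smoothTransition (s - k))) := fun c b k hc =>
      hc.comp (contDiff_const.mul (hst.comp (contDiff_id.sub contDiff_const)))
    exact (e c1 b1 0 hc1).add ((e c2 b2 1 hc2).sub contDiff_const)
  have hC0 : C 0 = p := by
    have : Real.smoothTransition (-1) = 0 := Real.smoothTransition.zero_of_nonpos (by norm_num)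
    simp [hC, h10, h20, this]
  have hC2 : C 2 = r := by
    have e : Real.smoothTransition 2 = 1 := Real.smoothTransition.one_of_one_le (by norm_num)
    have e' : (2:ℝ) - 1 = 1 := by norm_num
    simp [hC, h11, h21, e, e']
  have hle := wDist_le (m := m) (by norm_num : (0:ℝ) ≤ 2) hCc hC0 hC2
  have hi := fun a b => (spd_cont hm hCc).intervalIntegrable (μ := MeasureTheory.volume) a b
  have e1 := wLength_reparam hm hc1 hb1 0 (C := C) (by
    intro s hs
    filter_upwards [isOpen_Ioo.mem_nhds hs] with x hx
    have : Real.smoothTransition (x - 1) = 0 :=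
      Real.smoothTransition.zero_of_nonpos (by linarith [hx.2])
    simp [hC, this, h20])
  have e2 := wLength_reparam hm hc2 hb2 1 (C := C) (by
    intro s hs
    filter_upwards [isOpen_Ioo.mem_nhds hs] with x hx
    have : Real.smoothTransition x = 1 :=
      Real.smoothTransition.one_of_one_le (by linarith [hx.1])
    simp [hC, this, h11])
  have e3 : wLength m C 0 2 = (∫ s in (0:ℝ)..(0+1), spd m C s) + ∫ s in (1:ℝ)..(1+1), spd m C s := by
    rw [wLength_eq, zero_add, one_add_one_eq_two]
    exact (intervalIntegral.integral_add_adjacent_intervals (hi 0 1) (hi 1 2)).symm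
  rw [e1, e2] at e3
  linarith

/-- `√(1 - ν²/m²)`, automatically zero where `m < ν`. -/
def Rf (m : ℝ → ℝ) (ν t : ℝ) : ℝ := Real.sqrt (1 - ν ^ 2 / m t ^ 2)

theorem Rf_cont {m : ℝ → ℝ} (hm : Continuous m) (hp : ∀ t, 0 < m t) (ν : ℝ) :
    Continuous (Rf m ν) := by
  unfold Rf
  apply Real.continuous_sqrt.comp
  exact continuous_const.sub (continuous_const.div (hm.pow 2) fun t => (pow_pos (hp t) 2).ne')

theorem Rf_nonneg (m : ℝ → ℝ) (ν t : ℝ) : 0 ≤ Rf m ν t := Real.sqrt_nonneg _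

theorem Rf_zero {m : ℝ → ℝ} (hp : ∀ t, 0 < m t) {ν t : ℝ} (h : m t ≤ ν) : Rf m ν t = 0 := by
  apply Real.sqrt_eq_zero_of_nonpos
  have := hp t
  rw [sub_nonpos, one_le_div (by positivity)]
  nlinarith

theorem Rf_sq {m : ℝ → ℝ} (hp : ∀ t, 0 < m t) {ν t : ℝ} (h0 : 0 ≤ ν) (h : ν ≤ m t) :
    Rf m ν t ^ 2 = 1 - ν ^ 2 / m t ^ 2 := by
  apply Real.sq_sqrt
  have := hp t
  rw [sub_nonneg, div_le_one (by positivity)]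
  nlinarith

theorem calib_point {m : ℝ → ℝ} (hp : ∀ t, 0 < m t) {ν t a b : ℝ} (h0 : 0 ≤ ν) (h : ν ≤ m t) :
    ν * b + Rf m ν t * a ≤ Real.sqrt (a ^ 2 + m t ^ 2 * b ^ 2) := by
  apply Real.le_sqrt_of_sq_le
  have h1 := Rf_sq hp h0 h
  have hm := hp t
  set R := Rf m ν t
  have h2 : ν ^ 2 = m t ^ 2 * (1 - R ^ 2) := by rw [h1]; field_simp; ring
  have h3 : (m t) ^ 2 * ((ν * b + R * a) ^ 2) ≤ m t ^ 2 * (a ^ 2 + m t ^ 2 * b ^ 2) := by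
    have : 0 ≤ (ν * a - R * (m t) ^ 2 * b) ^ 2 := sq_nonneg _
    have e : m t ^ 2 * (a ^ 2 + m t ^ 2 * b ^ 2) - (m t) ^ 2 * ((ν * b + R * a) ^ 2)
       = (ν * a - R * (m t) ^ 2 * b) ^ 2 := by
      linear_combination ((m t)^2 * b^2 * (-1) - a^2) * h2
    linarith
  exact le_of_mul_le_mul_left h3 (by positivity)

/-- Calibration on a piece of a curve. -/
theorem calib_piece {m : ℝ → ℝ} (hm : Continuous m) (hp : ∀ t, 0 < m t) {ν : ℝ} (h0 : 0 ≤ ν)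
    {c : ℝ → ℝ × ℝ} (hc : ContDiff ℝ 1 c) {x y : ℝ} (hxy : x ≤ y)
    (h : ∀ s ∈ Icc x y, ν ≤ m (c s).1) :
    ν * ((c y).2 - (c x).2) + |∫ t in (c x).1..(c y).1, Rf m ν t| ≤ ∫ s in x..y, spd m c s := by
  have hc1 : ContDiff ℝ 1 (fun u => (c u).1) := hc.fst
  have hc2 : ContDiff ℝ 1 (fun u => (c u).2) := hc.snd
  have k1 := hc1.continuous_deriv (by norm_num)
  have k2 := hc2.continuous_deriv (by norm_num)
  have kR := Rf_cont hm hp ν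
  have kR' : Continuous fun s => Rf m ν (c s).1 := kR.comp hc1.continuous
  have e1 : ∫ s in x..y, deriv (fun u => (c u).2) s = (c y).2 - (c x).2 :=
    intervalIntegral.integral_deriv_eq_sub (fun s _ => hc2.differentiable (by norm_num) s)
      (k2.intervalIntegrable _ _)
  have e2 : ∫ s in x..y, Rf m ν (c s).1 * deriv (fun u => (c u).1) s =
      ∫ t in (c x).1..(c y).1, Rf m ν t :=
    intervalIntegral.integral_comp_mul_deriv (f := fun u => (c u).1)
      (fun s _ => (hc1.differentiable (by norm_num) s).hasDerivAt) k1.continuousOn kR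
  have main : ∀ σ : ℝ, σ ^ 2 = 1 →
      ν * ((c y).2 - (c x).2) + σ * ∫ t in (c x).1..(c y).1, Rf m ν t ≤
        ∫ s in x..y, spd m c s := by
    intro σ hσ
    rw [← e1, ← e2, ← intervalIntegral.integral_const_mul, ← intervalIntegral.integral_const_mul,
      ← intervalIntegral.integral_add]
    · apply intervalIntegral.integral_mono_on hxy
      · apply Continuous.intervalIntegrable; fun_prop
      · exact (spd_cont hm hc).intervalIntegrable _ _
      · intro s hs
        have := calib_point hp (a := σ * deriv (fun u => (c u).1) s)
          (b := deriv (fun u => (c u).2) s) h0 (h s hs)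
        rw [mul_pow, hσ, one_mul] at this
        unfold spd
        linarith
    · apply Continuous.intervalIntegrable; fun_prop
    · apply Continuous.intervalIntegrable; fun_prop
  rcases abs_choice (∫ t in (c x).1..(c y).1, Rf m ν t) with e | e <;> rw [e]
  · simpa using main 1 (by norm_num)
  · simpa using main (-1) (by norm_num)

theorem calib_curve {m : ℝ → ℝ} (hm : Continuous m) (hp : ∀ t, 0 < m t) {ν : ℝ} (h0 : 0 ≤ ν)
    {c : ℝ → ℝ × ℝ} (hc : ContDiff ℝ 1 c) {s b : ℝ} (hs : 0 ≤ s) (hsb : s ≤ b)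
    (h : ∀ s ∈ Icc 0 b, ν ≤ m (c s).1) :
    ν * ((c b).2 - (c 0).2) + |∫ t in (c 0).1..(c s).1, Rf m ν t|
      + |∫ t in (c s).1..(c b).1, Rf m ν t| ≤ wLength m c 0 b := by
  have i := fun a b => (spd_cont hm hc).intervalIntegrable (μ := MeasureTheory.volume) a b
  have e1 := calib_piece hm hp h0 hc hs fun x hx => h x ⟨hx.1, hx.2.trans hsb⟩
  have e2 := calib_piece hm hp h0 hc hsb fun x hx => h x ⟨hs.trans hx.1, hx.2⟩
  rw [wLength_eq, ← intervalIntegral.integral_add_adjacent_intervals (i 0 s) (i s b)]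
  linarith

end

section
open Real Set

open MeasureTheory intervalIntegral in
theorem ftc_nonneg {a b : ℝ} (hab : a ≤ b) {g g' : ℝ → ℝ} (hc : ContinuousOn g (Icc a b))
    (hd : ∀ x ∈ Ioo a b, HasDerivAt g (g' x) x) (hp : ∀ x ∈ Ioo a b, 0 ≤ g' x) :
    IntervalIntegrable g' volume a b ∧ ∫ x in a..b, g' x = g b - g a := by
  have hi : IntervalIntegrable g' volume a b := by
    apply intervalIntegrable_deriv_of_nonneg
    · rwa [uIcc_of_le hab]
    · rw [min_eq_left hab, max_eq_right hab]; exact hd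
    · rw [min_eq_left hab, max_eq_right hab]; exact hp
  exact ⟨hi, integral_eq_sub_of_hasDerivAt_of_le hab hc hd hi⟩

open MeasureTheory intervalIntegral in
theorem sign_lemma {a b : ℝ} (hab : a ≤ b) {k w : ℝ → ℝ} {ws : ℝ} (hws : 0 < ws)
    (hk : IntervalIntegrable k volume a b) (hkw : IntervalIntegrable (fun x => k x * w x) volume a b)
    (hpt : ∀ x ∈ Ioo a b, k x * w x ≤ ws * k x) (h0 : 0 ≤ ∫ x in a..b, k x * w x) :
    0 ≤ ∫ x in a..b, k x := by
  have h1 : ∫ x in a..b, k x * w x ≤ ∫ x in a..b, ws * k x :=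
    integral_mono_on_of_le_Ioo hab hkw (hk.const_mul ws) hpt
  rw [intervalIntegral.integral_const_mul] at h1
  by_contra hn
  push Not at hn
  nlinarith

/-- The angular density `ν / (m √(m² - ν²))`. -/
def kap (m : ℝ → ℝ) (ν t : ℝ) : ℝ := ν / (m t * Real.sqrt ((m t) ^ 2 - ν ^ 2))

theorem sqrt_eq_mul_Rf {m : ℝ → ℝ} (hp : ∀ t, 0 < m t) (ν t : ℝ) :
    Real.sqrt ((m t) ^ 2 - ν ^ 2) = m t * Rf m ν t := by
  unfold Rf
  have := hp t
  have e : (m t) ^ 2 - ν ^ 2 = m t ^ 2 * (1 - ν ^ 2 / m t ^ 2) := by field_simp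
  rw [e, Real.sqrt_mul (by positivity), Real.sqrt_sq this.le]

theorem kap_eq {m : ℝ → ℝ} (hp : ∀ t, 0 < m t) (ν t : ℝ) :
    kap m ν t = ν / (m t ^ 2 * Rf m ν t) := by
  unfold kap
  rw [sqrt_eq_mul_Rf hp]
  congr 1; ring

theorem kap_zero {m : ℝ → ℝ} (hp : ∀ t, 0 < m t) {ν t : ℝ} (h : m t ≤ ν) : kap m ν t = 0 := by
  rw [kap_eq hp, Rf_zero hp h]; simp

theorem kap_nonneg {m : ℝ → ℝ} (hp : ∀ t, 0 < m t) {ν t : ℝ} (h : 0 ≤ ν) : 0 ≤ kap m ν t := by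
  have := hp t
  unfold kap; positivity

theorem Rf_pos {m : ℝ → ℝ} (hp : ∀ t, 0 < m t) {ν t : ℝ} (h0 : 0 ≤ ν) (h : ν < m t) :
    0 < Rf m ν t := by
  have := hp t
  apply Real.sqrt_pos.2
  rw [sub_pos, div_lt_one (by positivity)]
  nlinarith

theorem kap_meas {m : ℝ → ℝ} (hm : Continuous m) (ν : ℝ) : Measurable (kap m ν) := by
  unfold kap
  have := hm.measurable
  fun_prop

/-- `R + ν κ = 1/R`. -/
theorem Rf_add_kap {m : ℝ → ℝ} (hp : ∀ t, 0 < m t) {ν t : ℝ} (h0 : 0 ≤ ν) (h : ν < m t) :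
    Rf m ν t + ν * kap m ν t = m t / Real.sqrt ((m t) ^ 2 - ν ^ 2) := by
  rw [kap_eq hp, sqrt_eq_mul_Rf hp]
  have h1 := Rf_sq hp h0 h.le
  have h2 := Rf_pos hp h0 h
  have h3 := hp t
  field_simp at h1 ⊢
  linarith

/-- The tangent-line defect of `ν ↦ R_ν`. -/
def dk (m : ℝ → ℝ) (ν ν0 t : ℝ) : ℝ := Rf m ν t - Rf m ν0 t + (ν - ν0) * kap m ν0 t

theorem dk_mul {m : ℝ → ℝ} (hp : ∀ t, 0 < m t) {ν ν0 t : ℝ} (h0 : 0 ≤ ν0) (h : ν0 < m t) :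
    dk m ν ν0 t * Rf m ν0 t = Rf m ν t * Rf m ν0 t - (1 - ν * ν0 / m t ^ 2) := by
  unfold dk
  rw [kap_eq hp]
  have h1 := Rf_sq hp h0 h.le
  have h2 := Rf_pos hp h0 h
  have h3 := hp t
  field_simp at h1 ⊢
  linear_combination (-1) * h1

theorem dk_nonpos {m : ℝ → ℝ} (hp : ∀ t, 0 < m t) {ν ν0 t : ℝ} (h0 : 0 ≤ ν0) (h0' : 0 ≤ ν)
    (h : ν0 < m t) (h2 : ν * ν0 ≤ m t ^ 2) : dk m ν ν0 t ≤ 0 := by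
  have e := dk_mul (ν := ν) hp h0 h
  have hR := Rf_pos hp h0 h
  have hm := hp t
  have h3 : ν * ν0 / m t ^ 2 ≤ 1 := by rw [div_le_one (by positivity)]; exact h2
  have : dk m ν ν0 t * Rf m ν0 t ≤ 0 := by
    rw [e]
    rcases le_total (m t) ν with c | c
    · rw [Rf_zero hp c]; linarith
    · have a1 := Rf_sq hp h0 h.le
      have a2 := Rf_sq hp h0' c
      have a3 : ν * ν0 / m t ^ 2 ≤ (ν^2/m t^2 + ν0^2/m t^2)/2 := by
        rw [← add_div, div_div, div_le_div_iff₀ (by positivity) (by positivity)]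
        nlinarith [sq_nonneg (ν - ν0), pow_pos hm 2, mul_nonneg (sq_nonneg (ν - ν0)) (pow_pos hm 2).le]
      nlinarith [sq_nonneg (Rf m ν t - Rf m ν0 t)]
  by_contra hn
  push Not at hn
  nlinarith [mul_pos hn hR]

theorem dk_nonneg {m : ℝ → ℝ} (hp : ∀ t, 0 < m t) {ν ν0 t : ℝ} (h0 : 0 ≤ ν0)
    (h : m t ≤ ν0 ∨ m t ^ 2 ≤ ν * ν0) : 0 ≤ dk m ν ν0 t := by
  rcases le_or_gt (m t) ν0 with c | c
  · unfold dk
    rw [kap_zero hp c, Rf_zero hp c]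
    have := Rf_nonneg m ν t
    linarith
  · have h2 : m t ^ 2 ≤ ν * ν0 := by
      rcases h with h | h
      · exact absurd h c.not_ge
      · exact h
    have e := dk_mul (ν := ν) hp h0 c
    have hR := Rf_pos hp h0 c
    have hm := hp t
    have h3 : 1 ≤ ν * ν0 / m t ^ 2 := by rw [one_le_div (by positivity)]; exact h2
    have h4 : 0 ≤ Rf m ν t * Rf m ν0 t := mul_nonneg (Rf_nonneg _ _ _) (Rf_nonneg _ _ _)
    by_contra hn
    push Not at hn
    nlinarith [mul_neg_of_neg_of_pos hn hR]

/-- threshold level for the sign of `dk` -/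
theorem exists_threshold {m : ℝ → ℝ} (hp : ∀ t, 0 < m t) {ν ν0 c : ℝ} (hc : 0 < c) (h : c ≤ ν)
    (h0 : c < ν0) : ∃ x, c < x ∧ x ≤ max ν ν0 ∧ (∀ t, x < m t → dk m ν ν0 t ≤ 0) ∧
      (∀ t, m t ≤ x → 0 ≤ dk m ν ν0 t) := by
  rcases le_total ν ν0 with a | a
  · refine ⟨ν0, h0, le_max_right _ _, fun t ht => dk_nonpos hp (by linarith) (by linarith) ht ?_,
      fun t ht => dk_nonneg hp (by linarith) (Or.inl ht)⟩
    nlinarith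
  · have k : 0 < ν * ν0 := by nlinarith
    have ks := Real.sq_sqrt k.le
    have kp := Real.sqrt_pos.2 k
    have k1 : ν0 ≤ √(ν * ν0) := by apply Real.le_sqrt_of_sq_le; nlinarith
    have k2 : √(ν * ν0) ≤ ν := by rw [Real.sqrt_le_left (by linarith)]; nlinarith
    refine ⟨√(ν * ν0), by linarith, le_max_of_le_left k2,
      fun t ht => dk_nonpos hp (by linarith) (by linarith) (by linarith) ?_,
      fun t ht => dk_nonneg hp (by linarith) (Or.inr ?_)⟩
    · nlinarith
    · have := hp t
      nlinarith

end

section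
open Real Set

/-- derivative of the first antiderivative -/
theorem y1_deriv {x0 ν x d : ℝ} {f : ℝ → ℝ} {t : ℝ} (hf : HasDerivAt f d t) (hx : f t = x)
    (h0 : 0 < ν) (h1 : ν < x) (h2 : x < x0) :
    HasDerivAt (fun t => (1/2) * arccos ((2 * f t ^ 2 - x0 ^ 2 - ν ^ 2) / (x0 ^ 2 - ν ^ 2)))
      (x / √(x ^ 2 - ν ^ 2) * (- d / √(x0 ^ 2 - x ^ 2))) t := by
  subst hx
  set x := f t
  have hx : 0 < x := h0.trans h1
  have a1 : 0 < x ^ 2 - ν ^ 2 := by nlinarith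
  have a2 : 0 < x0 ^ 2 - x ^ 2 := by nlinarith
  have a3 : 0 < x0 ^ 2 - ν ^ 2 := by nlinarith
  set y := (2 * x ^ 2 - x0 ^ 2 - ν ^ 2) / (x0 ^ 2 - ν ^ 2) with hy
  have e : 1 - y ^ 2 = (2 * (√(x ^ 2 - ν ^ 2) * √(x0 ^ 2 - x ^ 2)) / (x0 ^ 2 - ν ^ 2)) ^ 2 := by
    rw [hy, div_pow _ (x0 ^ 2 - ν ^ 2), div_pow _ (x0 ^ 2 - ν ^ 2), mul_pow _ (_ * _), mul_pow (√_) (√_), Real.sq_sqrt a1.le, Real.sq_sqrt a2.le]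
    field_simp; ring
  have s1 := Real.sqrt_pos.2 a1
  have s2 := Real.sqrt_pos.2 a2
  have e2 : √(1 - y ^ 2) = 2 * (√(x ^ 2 - ν ^ 2) * √(x0 ^ 2 - x ^ 2)) / (x0 ^ 2 - ν ^ 2) := by
    rw [e, Real.sqrt_sq (by positivity)]
  have n : 0 < 1 - y ^ 2 := by rw [e]; positivity
  have n1 : y ≠ -1 := by rintro h; rw [h] at n; norm_num at n
  have n2 : y ≠ 1 := by rintro h; rw [h] at n; norm_num at n
  have hin : HasDerivAt (fun t => (2 * f t ^ 2 - x0 ^ 2 - ν ^ 2) / (x0 ^ 2 - ν ^ 2))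
      ((4 * x * d) / (x0 ^ 2 - ν ^ 2)) t := by
    refine ((((hf.pow 2).const_mul 2).sub_const (x0^2)).sub_const (ν^2)).div_const _
      |>.congr_deriv ?_
    simp; ring
  refine (((hasDerivAt_arccos n1 n2).comp t hin).const_mul (1/2)).congr_deriv ?_
  rw [e2]
  field_simp
  norm_num

theorem y2_deriv {x0 ν x d : ℝ} {f : ℝ → ℝ} {t : ℝ} (hf : HasDerivAt f d t) (hx : f t = x)
    (h0 : 0 < ν) (h1 : ν < x) (h2 : x < x0) :
    HasDerivAt (fun t => (1/(2*x0)) * arccos ((x0 ^ 2 + ν ^ 2) / (x0 ^ 2 - ν ^ 2)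
        - 2 * ν ^ 2 * x0 ^ 2 / (x0 ^ 2 - ν ^ 2) * (f t ^ 2)⁻¹))
      (ν / (x * √(x ^ 2 - ν ^ 2)) * (- d / √(x0 ^ 2 - x ^ 2))) t := by
  subst hx
  set x := f t
  have hx : 0 < x := h0.trans h1
  have hx0 : 0 < x0 := hx.trans h2
  have a1 : 0 < x ^ 2 - ν ^ 2 := by nlinarith
  have a2 : 0 < x0 ^ 2 - x ^ 2 := by nlinarith
  have a3 : 0 < x0 ^ 2 - ν ^ 2 := by nlinarith
  set y := (x0 ^ 2 + ν ^ 2) / (x0 ^ 2 - ν ^ 2)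
        - 2 * ν ^ 2 * x0 ^ 2 / (x0 ^ 2 - ν ^ 2) * (x ^ 2)⁻¹ with hy
  have e : 1 - y ^ 2 = (2 * ν * x0 * (√(x ^ 2 - ν ^ 2) * √(x0 ^ 2 - x ^ 2)) /
      (x ^ 2 * (x0 ^ 2 - ν ^ 2))) ^ 2 := by
    rw [div_pow, mul_pow, mul_pow _ (√_), Real.sq_sqrt a1.le, Real.sq_sqrt a2.le, hy]
    field_simp; ring
  have s1 := Real.sqrt_pos.2 a1
  have s2 := Real.sqrt_pos.2 a2
  have e2 : √(1 - y ^ 2) = 2 * ν * x0 * (√(x ^ 2 - ν ^ 2) * √(x0 ^ 2 - x ^ 2)) /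
      (x ^ 2 * (x0 ^ 2 - ν ^ 2)) := by
    rw [e, Real.sqrt_sq (by positivity)]
  have n : 0 < 1 - y ^ 2 := by rw [e]; positivity
  have n1 : y ≠ -1 := by rintro h; rw [h] at n; norm_num at n
  have n2 : y ≠ 1 := by rintro h; rw [h] at n; norm_num at n
  have hin : HasDerivAt (fun t => (x0 ^ 2 + ν ^ 2) / (x0 ^ 2 - ν ^ 2)
        - 2 * ν ^ 2 * x0 ^ 2 / (x0 ^ 2 - ν ^ 2) * (f t ^ 2)⁻¹)
      ((4 * ν ^ 2 * x0 ^ 2 * d) / (x ^ 3 * (x0 ^ 2 - ν ^ 2))) t := by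
    refine ((((hf.pow 2).inv (pow_pos hx 2).ne').const_mul
      (2 * ν ^ 2 * x0 ^ 2 / (x0 ^ 2 - ν ^ 2))).const_sub _).congr_deriv ?_
    simp only [Pi.pow_apply]
    change -(_ * (-(_ * x ^ _ * _) / (x ^ 2) ^ 2)) = _
    field_simp
    norm_num
    ring
  refine (((hasDerivAt_arccos n1 n2).comp t hin).const_mul (1/(2*x0))).congr_deriv ?_
  rw [e2]
  field_simp
  norm_num

namespace MH
variable {m : ℝ → ℝ} {t0 : ℝ}
open MeasureTheory intervalIntegral

theorem wgt_pos (h : MH m t0) {t : ℝ} (h0 : 0 < t) (h1 : t < t0) : 0 < wgt m t := by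
  unfold wgt
  have a := h.dneg t h0 h1
  have b : m t < m 0 := h.anti ⟨le_rfl, h.t0pos.le⟩ ⟨h0.le, h1.le⟩ h0
  have c := h.pos t
  have : 0 < √(m 0 ^ 2 - m t ^ 2) := Real.sqrt_pos.2 (by nlinarith)
  apply div_pos _ this
  linarith

theorem exists_xi (h : MH m t0) {ν : ℝ} (h0 : m t0 ≤ ν) (h1 : ν < m 0) :
    ∃ ξ, 0 < ξ ∧ ξ ≤ t0 ∧ m ξ = ν := by
  obtain ⟨ξ, hξ, e⟩ := intermediate_value_Icc' h.t0pos.le h.cont.continuousOn ⟨h0, h1.le⟩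
  refine ⟨ξ, lt_of_le_of_ne hξ.1 ?_, hξ.2, e⟩
  rintro rfl
  exact h1.ne e.symm

/-- extension by zero beyond the turning point -/
theorem ext_zero {a b c : ℝ} {f : ℝ → ℝ} (hab : IntervalIntegrable f volume a b)
    (hz : ∀ x ∈ Set.uIcc b c, f x = 0) :
    IntervalIntegrable f volume a c ∧ ∫ x in a..c, f x = ∫ x in a..b, f x := by
  have e0 : IntervalIntegrable f volume b c := by
    apply (IntervalIntegrable.zero (μ := volume) (a := b) (b := c)).congr
    intro x hx
    simp [hz x (uIoc_subset_uIcc hx)]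
  have e1 : ∫ x in b..c, f x = 0 := by
    rw [intervalIntegral.integral_congr (g := fun _ => 0) (fun x hx => hz x hx)]
    simp
  exact ⟨hab.trans e0, by rw [← integral_add_adjacent_intervals hab e0, e1, add_zero]⟩

theorem B_kap_w (h : MH m t0) {ν : ℝ} (h0 : m t0 ≤ ν) (h1 : ν < m 0) :
    IntervalIntegrable (fun t => kap m ν t * wgt m t) volume 0 t0 ∧
    ∫ t in (0:ℝ)..t0, kap m ν t * wgt m t = π / (2 * m 0) := by
  obtain ⟨ξ, p0, p1, rfl⟩ := h.exists_xi h0 h1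
  have hν := h.pos ξ
  have hb : ∀ t ∈ Ioo 0 ξ, m ξ < m t ∧ m t < m 0 := fun t ht =>
    ⟨h.anti ⟨ht.1.le, ht.2.le.trans p1⟩ ⟨p0.le, p1⟩ ht.2,
      h.anti ⟨le_rfl, h.t0pos.le⟩ ⟨ht.1.le, ht.2.le.trans p1⟩ ht.1⟩
  have hsq : 0 < m 0 ^ 2 - m ξ ^ 2 := by nlinarith
  have main := ftc_nonneg p0.le (g := fun t => (1/(2*m 0)) * arccos ((m 0 ^ 2 + m ξ ^ 2) /
        (m 0 ^ 2 - m ξ ^ 2) - 2 * m ξ ^ 2 * m 0 ^ 2 / (m 0 ^ 2 - m ξ ^ 2) * (m t ^ 2)⁻¹))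
    (g' := fun t => kap m (m ξ) t * wgt m t) (by
      apply Continuous.continuousOn
      have : Continuous fun t => (m t ^ 2)⁻¹ := (h.cont.pow 2).inv₀ fun t =>
        (pow_pos (h.pos t) 2).ne'
      have hh := Real.continuous_arccos
      fun_prop)
    (fun t ht => y2_deriv (h.hd t) rfl hν (hb t ht).1 (hb t ht).2)
    (fun t ht => mul_nonneg (kap_nonneg h.pos hν.le) (h.wgt_pos ht.1 (ht.2.trans_le p1)).le)
  have ez := ext_zero (c := t0) main.1 (by
    intro x hx
    rw [uIcc_of_le p1] at hx
    rw [kap_zero h.pos, zero_mul]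
    exact h.anti.antitoneOn ⟨p0.le, p1⟩ ⟨p0.le.trans hx.1, hx.2⟩ hx.1)
  refine ⟨ez.1, ?_⟩
  rw [ez.2, main.2]
  have hm0 := h.pos 0
  have e1 : (m 0 ^ 2 + m ξ ^ 2) / (m 0 ^ 2 - m ξ ^ 2) -
    2 * m ξ ^ 2 * m 0 ^ 2 / (m 0 ^ 2 - m ξ ^ 2) * (m ξ ^ 2)⁻¹ = -1 := by
    field_simp; ring
  have e2 : (m 0 ^ 2 + m ξ ^ 2) / (m 0 ^ 2 - m ξ ^ 2) -
    2 * m ξ ^ 2 * m 0 ^ 2 / (m 0 ^ 2 - m ξ ^ 2) * (m 0 ^ 2)⁻¹ = 1 := by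
    field_simp; ring
  simp only [e1, e2, arccos_neg_one, arccos_one]
  field_simp
  ring

theorem B_R_w (h : MH m t0) {ν : ℝ} (h0 : m t0 ≤ ν) (h1 : ν < m 0) :
    IntervalIntegrable (fun t => Rf m ν t * wgt m t) volume 0 t0 ∧
    ∫ t in (0:ℝ)..t0, Rf m ν t * wgt m t = π / 2 * (1 - ν / m 0) := by
  have hk := h.B_kap_w h0 h1
  obtain ⟨ξ, p0, p1, rfl⟩ := h.exists_xi h0 h1
  have hν := h.pos ξ
  have hb : ∀ t ∈ Ioo 0 ξ, m ξ < m t ∧ m t < m 0 := fun t ht =>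
    ⟨h.anti ⟨ht.1.le, ht.2.le.trans p1⟩ ⟨p0.le, p1⟩ ht.2,
      h.anti ⟨le_rfl, h.t0pos.le⟩ ⟨ht.1.le, ht.2.le.trans p1⟩ ht.1⟩
  have hsq : 0 < m 0 ^ 2 - m ξ ^ 2 := by nlinarith
  have main := ftc_nonneg p0.le (g := fun t => (1/2) * arccos ((2 * m t ^ 2 - m 0 ^ 2 - m ξ ^ 2) /
        (m 0 ^ 2 - m ξ ^ 2)))
    (g' := fun t => (Rf m (m ξ) t + m ξ * kap m (m ξ) t) * wgt m t) (by
      apply Continuous.continuousOn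
      have hh := Real.continuous_arccos
      have hm := h.cont
      fun_prop)
    (fun t ht => by
      rw [Rf_add_kap h.pos hν.le (hb t ht).1]
      exact y1_deriv (h.hd t) rfl hν (hb t ht).1 (hb t ht).2)
    (fun t ht => mul_nonneg (add_nonneg (Rf_nonneg _ _ _) (mul_nonneg hν.le
      (kap_nonneg h.pos hν.le))) (h.wgt_pos ht.1 (ht.2.trans_le p1)).le)
  have ez := ext_zero (c := t0) main.1 (by
    intro x hx
    rw [uIcc_of_le p1] at hx
    have : m x ≤ m ξ := h.anti.antitoneOn ⟨p0.le, p1⟩ ⟨p0.le.trans hx.1, hx.2⟩ hx.1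
    rw [kap_zero h.pos this, Rf_zero h.pos this]
    ring)
  have ee : (fun t => Rf m (m ξ) t * wgt m t) = fun t =>
      (Rf m (m ξ) t + m ξ * kap m (m ξ) t) * wgt m t - m ξ * (kap m (m ξ) t * wgt m t) := by
    ext t; ring
  rw [ee]
  refine ⟨ez.1.sub (hk.1.const_mul _), ?_⟩
  rw [intervalIntegral.integral_sub ez.1 (hk.1.const_mul _), intervalIntegral.integral_const_mul,
    hk.2, ez.2, main.2]
  have hm0 := h.pos 0
  have e1 : (2 * m ξ ^ 2 - m 0 ^ 2 - m ξ ^ 2) / (m 0 ^ 2 - m ξ ^ 2) = -1 := by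
    field_simp; ring
  have e2 : (2 * m 0 ^ 2 - m 0 ^ 2 - m ξ ^ 2) / (m 0 ^ 2 - m ξ ^ 2) = 1 := by
    field_simp; ring
  simp only [e1, e2, arccos_neg_one, arccos_one]
  field_simp
  ring

theorem B_kap_int (h : MH m t0) {ν : ℝ} (h0 : m t0 < ν) (h1 : ν < m 0) :
    IntervalIntegrable (fun t => kap m ν t) volume 0 t0 := by
  have hk := h.B_kap_w h0.le h1
  obtain ⟨ξ, p0, p1, rfl⟩ := h.exists_xi h0.le h1
  have hν := h.pos ξ
  have p1' : ξ < t0 := lt_of_le_of_ne p1 (by rintro rfl; exact h0.ne rfl)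
  have hw := h.wgt_pos p0 p1'
  have k1 : IntervalIntegrable (fun t => kap m (m ξ) t * wgt m t) volume 0 ξ :=
    hk.1.mono_set (by rw [uIcc_of_le p0.le, uIcc_of_le h.t0pos.le]; exact Icc_subset_Icc_right p1)
  refine (ext_zero (b := ξ) ?_ ?_).1
  · refine (k1.const_mul (wgt m ξ)⁻¹).mono_fun (kap_meas h.cont _).aestronglyMeasurable ?_
    refine (ae_restrict_iff' measurableSet_uIoc).2 (Filter.Eventually.of_forall fun t ht => ?_)
    rw [uIoc_of_le p0.le] at ht
    have a := h.wanti t ξ ht.1 ht.2 p1'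
    have b : 0 ≤ kap m (m ξ) t := kap_nonneg h.pos hν.le
    beta_reduce
    rw [Real.norm_of_nonneg b, Real.norm_of_nonneg
      (mul_nonneg (inv_nonneg.2 hw.le) (mul_nonneg b (hw.le.trans a)))]
    rw [inv_mul_eq_div, le_div_iff₀ hw]
    exact mul_le_mul_of_nonneg_left a b
  · intro x hx
    rw [uIcc_of_le p1] at hx
    apply kap_zero h.pos
    exact h.anti.antitoneOn ⟨p0.le, p1⟩ ⟨p0.le.trans hx.1, hx.2⟩ hx.1

theorem B_sign (h : MH m t0) {k : ℝ → ℝ} {x : ℝ} (hx0 : m t0 < x) (hx1 : x < m 0)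
    (hk : IntervalIntegrable k volume 0 t0)
    (hkw : IntervalIntegrable (fun x => k x * wgt m x) volume 0 t0)
    (h1 : ∀ t, x < m t → k t ≤ 0) (h2 : ∀ t, m t ≤ x → 0 ≤ k t)
    (h0 : 0 ≤ ∫ x in (0:ℝ)..t0, k x * wgt m x) :
    0 ≤ ∫ x in (0:ℝ)..t0, k x := by
  obtain ⟨ξ, p0, p1, rfl⟩ := h.exists_xi hx0.le hx1
  have p1' : ξ < t0 := lt_of_le_of_ne p1 (by rintro rfl; exact hx0.ne rfl)
  refine sign_lemma h.t0pos.le (h.wgt_pos p0 p1') hk hkw (fun t ht => ?_) h0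
  rcases lt_or_ge t ξ with c | c
  · have a := h1 t (h.anti ⟨ht.1.le, ht.2.le⟩ ⟨p0.le, p1⟩ c)
    have b := h.wanti t ξ ht.1 c.le p1'
    nlinarith
  · have a := h2 t (h.anti.antitoneOn ⟨p0.le, p1⟩ ⟨ht.1.le, ht.2.le⟩ c)
    have b := h.wanti ξ t p0 c ht.2
    nlinarith

theorem B_ineq (h : MH m t0) {ν ν0 : ℝ} (h0 : m t0 ≤ ν) (h1 : ν < m 0) (h2 : m t0 < ν0)
    (h3 : ν0 < m 0) :
    ν0 * (∫ t in (0:ℝ)..t0, kap m ν0 t) + ∫ t in (0:ℝ)..t0, Rf m ν0 t ≤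
    ν * (∫ t in (0:ℝ)..t0, kap m ν0 t) + ∫ t in (0:ℝ)..t0, Rf m ν t := by
  obtain ⟨x, hx0, hx1, hx2, hx3⟩ := exists_threshold h.pos (h.pos t0) h0 h2
  have i1 := (Rf_cont h.cont h.pos ν).intervalIntegrable (μ := volume) 0 t0
  have i2 := (Rf_cont h.cont h.pos ν0).intervalIntegrable (μ := volume) 0 t0
  have i3 := h.B_kap_int h2 h3
  have j1 := h.B_R_w h0 h1
  have j2 := h.B_R_w h2.le h3
  have j3 := h.B_kap_w h2.le h3
  have ew : (fun t => dk m ν ν0 t * wgt m t) = fun t => Rf m ν t * wgt m t - Rf m ν0 t * wgt m t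
      + (ν - ν0) * (kap m ν0 t * wgt m t) := by
    ext t; unfold dk; ring
  have e : ∫ t in (0:ℝ)..t0, dk m ν ν0 t = (∫ t in (0:ℝ)..t0, Rf m ν t) -
      (∫ t in (0:ℝ)..t0, Rf m ν0 t) + (ν - ν0) * ∫ t in (0:ℝ)..t0, kap m ν0 t := by
    unfold dk
    rw [intervalIntegral.integral_add (i1.sub i2) (i3.const_mul _),
      intervalIntegral.integral_sub i1 i2, intervalIntegral.integral_const_mul]
  have := h.B_sign (k := dk m ν ν0) hx0 (hx1.trans_lt (max_lt h1 h3))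
    ((i1.sub i2).add (i3.const_mul _))
    (by rw [ew]; exact (j1.1.sub j2.1).add (j3.1.const_mul _)) hx2 hx3
    (by
      rw [ew, intervalIntegral.integral_add (j1.1.sub j2.1) (j3.1.const_mul _),
        intervalIntegral.integral_sub j1.1 j2.1, intervalIntegral.integral_const_mul, j1.2, j2.2,
        j3.2]
      apply le_of_eq
      have := h.pos 0
      field_simp
      ring)
  rw [e] at this
  linarith

theorem B_mono (h : MH m t0) {ν ν0 : ℝ} (h0 : m t0 < ν0) (h1 : ν0 ≤ ν) (h3 : ν < m 0) :
    ∫ t in (0:ℝ)..t0, kap m ν t ≤ ∫ t in (0:ℝ)..t0, kap m ν0 t := by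
  have i1 := h.B_kap_int h0 (h1.trans_lt h3)
  have i2 := h.B_kap_int (h0.trans_le h1) h3
  have j1 := h.B_kap_w h0.le (h1.trans_lt h3)
  have j2 := h.B_kap_w (h0.trans_le h1).le h3
  have ew : (fun t => (kap m ν0 t - kap m ν t) * wgt m t) = fun t => kap m ν0 t * wgt m t
      - kap m ν t * wgt m t := by
    ext t; ring
  have hν0 : 0 < ν0 := (h.pos t0).trans h0
  have hν : 0 < ν := hν0.trans_le h1
  have := h.B_sign (k := fun t => kap m ν0 t - kap m ν t) (h0.trans_le h1) h3
    (i1.sub i2) (by rw [ew]; exact j1.1.sub j2.1)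
    (fun t ht => by
      have hp := h.pos t
      unfold kap
      have : 0 < √(m t ^ 2 - ν ^ 2) := Real.sqrt_pos.2 (by nlinarith)
      rw [sub_nonpos]
      gcongr)
    (fun t ht => by
      rw [kap_zero h.pos ht, sub_zero]
      exact kap_nonneg h.pos hν0.le)
    (by rw [ew, intervalIntegral.integral_sub j1.1 j2.1, j1.2, j2.2, sub_self])
  rw [intervalIntegral.integral_sub i1 i2] at this
  linarith

end MH

end

section
open Real Set

theorem arccos_div_deriv {m : ℝ → ℝ} (hp : ∀ t, 0 < m t) {ν t d : ℝ} (hf : HasDerivAt m d t)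
    (h0 : 0 < ν) (h1 : ν < m t) :
    HasDerivAt (fun t => arccos (ν / m t)) (kap m ν t * d) t := by
  have hx := hp t
  have hy : ν / m t < 1 := by rw [div_lt_one hx]; exact h1
  have hy0 : 0 < ν / m t := by positivity
  have hin : HasDerivAt (fun t => ν / m t) (-(ν * d) / m t ^ 2) t := by
    refine ((hasDerivAt_const t ν).div hf hx.ne').congr_deriv ?_
    ring
  refine ((hasDerivAt_arccos (by linarith) hy.ne).comp t hin).congr_deriv ?_
  rw [kap_eq hp]
  unfold Rf
  rw [div_pow]
  have : 0 < √(1 - ν ^ 2 / m t ^ 2) := Rf_pos hp h0.le h1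
  field_simp

theorem G_deriv {m : ℝ → ℝ} (hp : ∀ t, 0 < m t) {ν t d : ℝ} (hf : HasDerivAt m d t)
    (h0 : 0 < ν) (h1 : ν < m t) :
    HasDerivAt (fun t => √(m t ^ 2 - ν ^ 2) - ν * arccos (ν / m t)) (Rf m ν t * d) t := by
  have hx := hp t
  have e0 : 0 < m t ^ 2 - ν ^ 2 := by nlinarith
  have e1 : HasDerivAt (fun t => m t ^ 2 - ν ^ 2) (2 * m t * d) t := by
    refine ((hf.pow 2).sub_const _).congr_deriv ?_
    simp
  refine ((e1.sqrt e0.ne').sub ((arccos_div_deriv hp hf h0 h1).const_mul ν)).congr_deriv ?_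
  have := Rf_add_kap hp h0.le h1
  have e2 : Rf m ν t = m t / √(m t ^ 2 - ν ^ 2) - ν * kap m ν t := by linarith
  rw [e2]
  have := Real.sqrt_pos.2 e0
  field_simp

theorem sin_tangent {α β : ℝ} (h0 : 0 ≤ α) (h1 : α ≤ π) (h2 : 0 ≤ β) (h3 : β ≤ π) :
    sin β ≤ sin α + (β - α) * cos α := by
  rcases lt_trichotomy α β with h | h | h
  · obtain ⟨c, hc, e⟩ := exists_hasDerivAt_eq_slope sin cos h continuous_sin.continuousOn
      (fun x _ => hasDerivAt_sin x)
    rw [eq_div_iff (by linarith)] at e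
    have := cos_le_cos_of_nonneg_of_le_pi h0 (hc.2.le.trans h3) hc.1.le
    nlinarith
  · subst h; simp
  · obtain ⟨c, hc, e⟩ := exists_hasDerivAt_eq_slope sin cos h continuous_sin.continuousOn
      (fun x _ => hasDerivAt_sin x)
    rw [eq_div_iff (by linarith)] at e
    have := cos_le_cos_of_nonneg_of_le_pi (h2.trans hc.1.le) h1 hc.2.le
    nlinarith

theorem G_convex {x ν ν0 : ℝ} (hx : 0 < x) (h0 : 0 ≤ ν) (h1 : ν ≤ x) (h2 : 0 ≤ ν0) (h3 : ν0 ≤ x) :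
    √(x ^ 2 - ν0 ^ 2) - ν0 * arccos (ν0 / x) ≤
    √(x ^ 2 - ν ^ 2) - ν * arccos (ν / x) + (ν - ν0) * arccos (ν0 / x) := by
  have e : ∀ ν, 0 ≤ ν → ν ≤ x → √(x ^ 2 - ν ^ 2) = x * sin (arccos (ν / x)) ∧
      ν = x * cos (arccos (ν / x)) := by
    intro ν h0 h1
    have a : ν / x ≤ 1 := by rw [div_le_one hx]; exact h1
    have b : 0 ≤ ν / x := by positivity
    rw [sin_arccos, cos_arccos (by linarith) a]
    constructor
    · have : x ^ 2 - ν ^ 2 = x ^ 2 * (1 - (ν / x) ^ 2) := by field_simp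
      rw [this, Real.sqrt_mul (by positivity), Real.sqrt_sq hx.le]
    · field_simp
  obtain ⟨a1, a2⟩ := e ν h0 h1
  obtain ⟨b1, b2⟩ := e ν0 h2 h3
  rw [a1, b1]
  set α := arccos (ν / x) with hα
  set β := arccos (ν0 / x) with hβ
  rw [a2, b2]
  have := sin_tangent (arccos_nonneg (ν / x)) (arccos_le_pi _) (arccos_nonneg (ν0 / x))
    (arccos_le_pi _)
  rw [← hα, ← hβ] at this
  nlinarith

namespace MH
variable {m : ℝ → ℝ} {t0 : ℝ}
open MeasureTheory intervalIntegral

theorem ext_zero' {a b c : ℝ} {f : ℝ → ℝ} (hbc : IntervalIntegrable f volume b c)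
    (hz : ∀ x ∈ Set.uIcc a b, f x = 0) :
    IntervalIntegrable f volume a c ∧ ∫ x in a..c, f x = ∫ x in b..c, f x := by
  have e0 : IntervalIntegrable f volume a b := by
    apply (IntervalIntegrable.zero (μ := volume) (a := a) (b := b)).congr
    intro x hx
    simp [hz x (uIoc_subset_uIcc hx)]
  have e1 : ∫ x in a..b, f x = 0 := by
    rw [intervalIntegral.integral_congr (g := fun _ => 0) (fun x hx => hz x hx)]
    simp
  exact ⟨e0.trans hbc, by rw [← integral_add_adjacent_intervals e0 hbc, e1, zero_add]⟩

theorem exists_xi' (h : MH m t0) {ν b : ℝ} (hb : t0 ≤ b) (h0 : m t0 ≤ ν) (h1 : ν ≤ m b) :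
    ∃ ξ, t0 ≤ ξ ∧ ξ ≤ b ∧ m ξ = ν := by
  obtain ⟨ξ, hξ, e⟩ := intermediate_value_Icc hb h.cont.continuousOn ⟨h0, h1⟩
  exact ⟨ξ, hξ.1, hξ.2, e⟩

theorem A_kap_w (h : MH m t0) {ν b : ℝ} (hb : t0 ≤ b) (h0 : m t0 ≤ ν) (h1 : ν ≤ m b) :
    IntervalIntegrable (fun t => kap m ν t * deriv m t) volume t0 b ∧
    ∫ t in t0..b, kap m ν t * deriv m t = arccos (ν / m b) := by
  obtain ⟨ξ, p0, p1, rfl⟩ := h.exists_xi' hb h0 h1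
  have hν := h.pos ξ
  have hlt : ∀ t ∈ Ioo ξ b, m ξ < m t := fun t ht => h.mono p0 (p0.trans ht.1.le) ht.1
  have main := ftc_nonneg p1 (g := fun t => arccos (m ξ / m t))
    (g' := fun t => kap m (m ξ) t * deriv m t) (by
      apply Continuous.continuousOn
      exact Real.continuous_arccos.comp (continuous_const.div h.cont fun t => (h.pos t).ne'))
    (fun t ht => arccos_div_deriv h.pos (h.hd t) hν (hlt t ht))
    (fun t ht => mul_nonneg (kap_nonneg h.pos hν.le) (h.dpos t (p0.trans_lt ht.1)).le)
  have ez := ext_zero' (a := t0) main.1 (by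
    intro x hx
    rw [uIcc_of_le p0] at hx
    rw [kap_zero h.pos, zero_mul]
    exact h.mono.monotoneOn hx.1 p0 hx.2)
  refine ⟨ez.1, ?_⟩
  rw [ez.2, main.2, div_self hν.ne', arccos_one, sub_zero]

theorem A_R_w (h : MH m t0) {ν b : ℝ} (hb : t0 ≤ b) (h0 : m t0 ≤ ν) (h1 : ν ≤ m b) :
    IntervalIntegrable (fun t => Rf m ν t * deriv m t) volume t0 b ∧
    ∫ t in t0..b, Rf m ν t * deriv m t = √(m b ^ 2 - ν ^ 2) - ν * arccos (ν / m b) := by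
  obtain ⟨ξ, p0, p1, rfl⟩ := h.exists_xi' hb h0 h1
  have hν := h.pos ξ
  have hlt : ∀ t ∈ Ioo ξ b, m ξ < m t := fun t ht => h.mono p0 (p0.trans ht.1.le) ht.1
  have main := ftc_nonneg p1 (g := fun t => √(m t ^ 2 - m ξ ^ 2) - m ξ * arccos (m ξ / m t))
    (g' := fun t => Rf m (m ξ) t * deriv m t) (by
      apply Continuous.continuousOn
      have : Continuous fun t => arccos (m ξ / m t) :=
        Real.continuous_arccos.comp (continuous_const.div h.cont fun t => (h.pos t).ne')
      have hm := h.cont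
      fun_prop)
    (fun t ht => G_deriv h.pos (h.hd t) hν (hlt t ht))
    (fun t ht => mul_nonneg (Rf_nonneg _ _ _) (h.dpos t (p0.trans_lt ht.1)).le)
  have ez := ext_zero' (a := t0) main.1 (by
    intro x hx
    rw [uIcc_of_le p0] at hx
    rw [Rf_zero h.pos, zero_mul]
    exact h.mono.monotoneOn hx.1 p0 hx.2)
  refine ⟨ez.1, ?_⟩
  rw [ez.2, main.2, div_self hν.ne', arccos_one]
  simp

theorem A_kap_int (h : MH m t0) {ν b : ℝ} (hb : t0 ≤ b) (h0 : m t0 < ν) (h1 : ν ≤ m b) :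
    IntervalIntegrable (fun t => kap m ν t) volume t0 b := by
  have hk := h.A_kap_w hb h0.le h1
  obtain ⟨ξ, p0, p1, rfl⟩ := h.exists_xi' hb h0.le h1
  have hν := h.pos ξ
  have p0' : t0 < ξ := lt_of_le_of_ne p0 (by rintro rfl; exact h0.ne rfl)
  have hw := h.dpos ξ p0'
  have k1 : IntervalIntegrable (fun t => kap m (m ξ) t * deriv m t) volume ξ b :=
    hk.1.mono_set (by rw [uIcc_of_le p1, uIcc_of_le hb]; exact Icc_subset_Icc_left p0)
  refine (ext_zero' (b := ξ) ?_ ?_).1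
  · refine (k1.const_mul (deriv m ξ)⁻¹).mono_fun (kap_meas h.cont _).aestronglyMeasurable ?_
    refine (ae_restrict_iff' measurableSet_uIoc).2 (Filter.Eventually.of_forall fun t ht => ?_)
    rw [uIoc_of_le p1] at ht
    have a := h.dmono p0 (p0.trans ht.1.le) ht.1.le
    have b : 0 ≤ kap m (m ξ) t := kap_nonneg h.pos hν.le
    beta_reduce
    rw [Real.norm_of_nonneg b, Real.norm_of_nonneg
      (mul_nonneg (inv_nonneg.2 hw.le) (mul_nonneg b (hw.le.trans a)))]
    rw [inv_mul_eq_div, le_div_iff₀ hw]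
    exact mul_le_mul_of_nonneg_left a b
  · intro x hx
    rw [uIcc_of_le p0] at hx
    apply kap_zero h.pos
    exact h.mono.monotoneOn hx.1 p0 hx.2

theorem A_ineq (h : MH m t0) {ν ν0 b : ℝ} (hb : t0 ≤ b) (h0 : m t0 ≤ ν) (h1 : ν ≤ m b)
    (h2 : m t0 < ν0) (h3 : ν0 ≤ m b) :
    ν0 * (∫ t in t0..b, kap m ν0 t) + ∫ t in t0..b, Rf m ν0 t ≤
    ν * (∫ t in t0..b, kap m ν0 t) + ∫ t in t0..b, Rf m ν t := by
  obtain ⟨x, hx0, hx1, hx2, hx3⟩ := exists_threshold h.pos (h.pos t0) h0 h2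
  have i1 := (Rf_cont h.cont h.pos ν).intervalIntegrable (μ := volume) t0 b
  have i2 := (Rf_cont h.cont h.pos ν0).intervalIntegrable (μ := volume) t0 b
  have i3 := h.A_kap_int hb h2 h3
  have j1 := h.A_R_w hb h0 h1
  have j2 := h.A_R_w hb h2.le h3
  have j3 := h.A_kap_w hb h2.le h3
  have ew : (fun t => dk m ν ν0 t * deriv m t) = fun t => Rf m ν t * deriv m t
      - Rf m ν0 t * deriv m t + (ν - ν0) * (kap m ν0 t * deriv m t) := by
    ext t; unfold dk; ring
  have e : ∫ t in t0..b, dk m ν ν0 t = (∫ t in t0..b, Rf m ν t) -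
      (∫ t in t0..b, Rf m ν0 t) + (ν - ν0) * ∫ t in t0..b, kap m ν0 t := by
    unfold dk
    rw [intervalIntegral.integral_add (i1.sub i2) (i3.const_mul _),
      intervalIntegral.integral_sub i1 i2, intervalIntegral.integral_const_mul]
  obtain ⟨ξ, p0, p1, rfl⟩ := h.exists_xi' hb hx0.le (hx1.trans (max_le h1 h3))
  have p0' : t0 < ξ := lt_of_le_of_ne p0 (by rintro rfl; exact hx0.ne rfl)
  have hp0 := h.pos t0
  have := sign_lemma (k := dk m ν ν0) (w := deriv m) hb (h.dpos ξ p0')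
    ((i1.sub i2).add (i3.const_mul _))
    (by rw [ew]; exact (j1.1.sub j2.1).add (j3.1.const_mul _)) (fun t ht => by
      rcases le_or_gt t ξ with c | c
      · have a := hx3 t (h.mono.monotoneOn ht.1.le p0 c)
        have b := h.dmono ht.1.le p0 c
        nlinarith
      · have a := hx2 t (h.mono p0 ht.1.le c)
        have b := h.dmono p0 ht.1.le c.le
        nlinarith)
    (by
      rw [ew, intervalIntegral.integral_add (j1.1.sub j2.1) (j3.1.const_mul _),
        intervalIntegral.integral_sub j1.1 j2.1, intervalIntegral.integral_const_mul, j1.2, j2.2,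
        j3.2]
      have := G_convex (h.pos b) (by linarith) h1 (by linarith) h3
      linarith)
  rw [e] at this
  linarith

end MH

end

section
open Real Set

/-- A unit speed geodesic `(t, θ)` with `t' = p` and Clairaut constant `ν`. -/
structure Geo (m : ℝ → ℝ) (ν : ℝ) (t p θ : ℝ → ℝ) : Prop where
  ht : ∀ s, HasDerivAt t (p s) s
  hp : ∀ s, HasDerivAt p (ν ^ 2 * (deriv m (t s) / m (t s) ^ 3)) s
  hθ : ∀ s, HasDerivAt θ (ν / m (t s) ^ 2) s
  he : ∀ s, p s ^ 2 + ν ^ 2 / m (t s) ^ 2 = 1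

theorem deriv_even {m : ℝ → ℝ} (he : ∀ t, m (-t) = m t) (x : ℝ) : deriv m (-x) = - deriv m x := by
  have h3 : (fun t => m (-t)) = m := funext he
  have := deriv_comp_neg m (x)
  rw [h3] at this
  linarith

namespace Geo
variable {m : ℝ → ℝ} {ν t0 : ℝ} {t p θ : ℝ → ℝ}

theorem tcont (g : Geo m ν t p θ) : Continuous t :=
  continuous_iff_continuousAt.2 fun s => (g.ht s).continuousAt
theorem pcont (g : Geo m ν t p θ) : Continuous p :=
  continuous_iff_continuousAt.2 fun s => (g.hp s).continuousAt
theorem θcont (g : Geo m ν t p θ) : Continuous θ :=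
  continuous_iff_continuousAt.2 fun s => (g.hθ s).continuousAt

theorem shift (g : Geo m ν t p θ) (c : ℝ) :
    Geo m ν (fun s => t (s + c)) (fun s => p (s + c)) (fun s => θ (s + c)) where
  ht s := (g.ht (s + c)).comp_add_const s c
  hp s := (g.hp (s + c)).comp_add_const s c
  hθ s := (g.hθ (s + c)).comp_add_const s c
  he s := g.he (s + c)

theorem rev (g : Geo m ν t p θ) :
    Geo m ν (fun s => t (-s)) (fun s => - p (-s)) (fun s => - θ (-s)) where
  ht s := ((g.ht (-s)).comp s (hasDerivAt_neg s)).congr_deriv (by ring)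
  hp s := ((g.hp (-s)).comp s (hasDerivAt_neg s)).neg.congr_deriv (by ring)
  hθ s := ((g.hθ (-s)).comp s (hasDerivAt_neg s)).neg.congr_deriv (by ring)
  he s := by rw [neg_sq]; exact g.he (-s)

theorem negt (g : Geo m ν t p θ) (he : ∀ t, m (-t) = m t) :
    Geo m ν (fun s => - t s) (fun s => - p s) θ where
  ht s := (g.ht s).neg
  hp s := (g.hp s).neg.congr_deriv (by rw [he, deriv_even he]; ring)
  hθ s := (g.hθ s).congr_deriv (by rw [he])
  he s := by rw [neg_sq, he]; exact g.he s

theorem negθ (g : Geo m ν t p θ) : Geo m (-ν) t p (fun s => - θ s) where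
  ht s := g.ht s
  hp s := (g.hp s).congr_deriv (by ring)
  hθ s := (g.hθ s).neg.congr_deriv (by ring)
  he s := by rw [neg_sq]; exact g.he s

theorem addθ (g : Geo m ν t p θ) (k : ℝ) : Geo m ν t p (fun s => θ s + k) where
  ht s := g.ht s
  hp s := g.hp s
  hθ s := (g.hθ s).add_const k
  he s := g.he s

theorem pabs (g : Geo m ν t p θ) (s : ℝ) : |p s| ≤ 1 := by
  have := g.he s
  have h : 0 ≤ ν ^ 2 / m (t s) ^ 2 := by positivity
  rw [abs_le]
  constructor <;> nlinarith

theorem ν_le (g : Geo m ν t p θ) (hm : ∀ t, 0 < m t) (s : ℝ) : ν ≤ m (t s) := by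
  have h1 := g.he s
  have h2 := hm (t s)
  by_contra hn
  push Not at hn
  have : 1 < ν ^ 2 / m (t s) ^ 2 := by rw [one_lt_div (by positivity)]; nlinarith
  nlinarith [sq_nonneg (p s)]

theorem Rf_eq (g : Geo m ν t p θ) (s : ℝ) : Rf m ν (t s) = |p s| := by
  unfold Rf
  rw [show 1 - ν ^ 2 / m (t s) ^ 2 = p s ^ 2 by linarith [g.he s], Real.sqrt_sq_eq_abs]

theorem p_zero_iff (g : Geo m ν t p θ) (hm : ∀ t, 0 < m t) (h0 : 0 ≤ ν) (s : ℝ) :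
    p s = 0 ↔ m (t s) = ν := by
  have h2 := hm (t s)
  have h3 := g.ν_le hm s
  have e := g.Rf_eq s
  constructor
  · intro h
    rw [h, abs_zero] at e
    by_contra hne
    exact (Rf_pos hm h0 (lt_of_le_of_ne h3 (Ne.symm hne))).ne' e
  · intro h
    rw [Rf_zero hm h.le] at e
    exact abs_eq_zero.1 e.symm

theorem lt_of_p (g : Geo m ν t p θ) (hm : ∀ t, 0 < m t) (h0 : 0 ≤ ν) {s : ℝ} (h : p s ≠ 0) :
    ν < m (t s) :=
  lt_of_le_of_ne (g.ν_le hm s) fun e => h ((g.p_zero_iff hm h0 s).2 e.symm)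

theorem t_lip (g : Geo m ν t p θ) (x y : ℝ) : |t y - t x| ≤ |y - x| := by
  have := Convex.norm_image_sub_le_of_norm_hasDerivWithin_le (f := t) (C := 1) (s := univ)
    (fun x _ => (g.ht x).hasDerivWithinAt) (fun x _ => g.pabs x) convex_univ (mem_univ x)
    (mem_univ y)
  simpa using this

theorem const_of_deriv_zero {f : ℝ → ℝ} {x y : ℝ} (hxy : x ≤ y) (hc : ContinuousOn f (Icc x y))
    (hd : ∀ s ∈ Ioo x y, HasDerivAt f 0 s) : f y = f x := by
  rcases hxy.eq_or_lt with rfl | h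
  · rfl
  obtain ⟨c, hc, e⟩ := exists_hasDerivAt_eq_slope f (fun _ => 0) h hc hd
  rw [eq_div_iff (by linarith)] at e
  linarith

/-- Length of a piece where `t` is nondecreasing. -/
theorem piece_len (g : Geo m ν t p θ) (hmc : Continuous m) (hm : ∀ t, 0 < m t)
    {x y : ℝ} (hxy : x ≤ y) (hs : ∀ s ∈ Ioo x y, 0 ≤ p s) :
    y - x = ν * (θ y - θ x) + ∫ r in (t x)..(t y), Rf m ν r := by
  have hR := Rf_cont hmc hm ν
  have hG : ∀ r, HasDerivAt (fun z => ∫ r in (t x)..z, Rf m ν r) (Rf m ν r) r := fun r =>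
    intervalIntegral.integral_hasDerivAt_right (hR.intervalIntegrable _ _)
      (hR.stronglyMeasurableAtFilter _ _) hR.continuousAt
  have hall : ∀ s, HasDerivAt (fun s => s - ν * θ s - ∫ r in (t x)..(t s), Rf m ν r)
      (1 - ν * (ν / m (t s) ^ 2) - Rf m ν (t s) * p s) s := fun s =>
    ((hasDerivAt_id s).sub ((g.hθ s).const_mul ν)).sub ((hG (t s)).comp s (g.ht s))
  have := const_of_deriv_zero hxy
    (f := fun s => s - ν * θ s - ∫ r in (t x)..(t s), Rf m ν r)
    (fun s _ => (hall s).continuousAt.continuousWithinAt)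
    (fun s hs' => (hall s).congr_deriv (by
      rw [g.Rf_eq, abs_of_nonneg (hs s hs')]
      have := g.he s
      rw [mul_div_assoc']
      linarith [show ν * ν = ν ^ 2 by ring, show p s * p s = p s ^ 2 by ring,
        show ν * ν / m (t s) ^ 2 = ν ^ 2 / m (t s) ^ 2 by ring]))
  simp only [intervalIntegral.integral_same] at this
  linarith

theorem piece_len' (g : Geo m ν t p θ) (hmc : Continuous m) (hm : ∀ t, 0 < m t)
    {x y : ℝ} (hxy : x ≤ y) (hs : ∀ s ∈ Ioo x y, p s ≤ 0) :
    y - x = ν * (θ y - θ x) + ∫ r in (t y)..(t x), Rf m ν r := by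
  have := g.rev.piece_len hmc hm (neg_le_neg hxy) (fun s hs' => by
    have := hs (-s) ⟨by linarith [hs'.2], by linarith [hs'.1]⟩
    simpa using this)
  simp only [neg_neg] at this
  linarith

open MeasureTheory in
/-- Angle of a piece where `t` is increasing. -/
theorem piece_ang (g : Geo m ν t p θ) (hmc : Continuous m) (hm : ∀ t, 0 < m t) (h0 : 0 ≤ ν)
    {x y : ℝ} (hxy : x ≤ y) (hs : ∀ s ∈ Ioo x y, 0 < p s)
    (hi : IntervalIntegrable (kap m ν) volume (t x) (t y)) :
    θ y - θ x = ∫ r in (t x)..(t y), kap m ν r := by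
  have hmono : StrictMonoOn t (Icc x y) :=
    strictMonoOn_of_deriv_pos (convex_Icc x y) g.tcont.continuousOn (fun s hs' => by
      rw [interior_Icc] at hs'; rw [(g.ht s).deriv]; exact hs s hs')
  have hmaps : ∀ s ∈ Icc x y, t s ∈ Icc (t x) (t y) := fun s hs' =>
    ⟨hmono.monotoneOn ⟨le_rfl, hxy⟩ hs' hs'.1, hmono.monotoneOn hs' ⟨hxy, le_rfl⟩ hs'.2⟩
  have hle := (hmaps y ⟨hxy, le_rfl⟩).1
  have hH : ContinuousOn (fun z => ∫ r in (t x)..z, kap m ν r) (Icc (t x) (t y)) := by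
    have := intervalIntegral.continuousOn_primitive_interval' hi left_mem_uIcc
    rwa [uIcc_of_le hle] at this
  have := const_of_deriv_zero hxy (f := fun s => θ s - ∫ r in (t x)..(t s), kap m ν r)
    (g.θcont.continuousOn.sub (hH.comp g.tcont.continuousOn hmaps))
    (fun s hs' => by
      have hps := hs s hs'
      have hlt := g.lt_of_p hm h0 hps.ne'
      have hms := hm (t s)
      have hc : ContinuousAt (kap m ν) (t s) := by
        unfold kap
        have : 0 < √(m (t s) ^ 2 - ν ^ 2) := Real.sqrt_pos.2 (by nlinarith)
        have hc := hmc.continuousAt (x := t s)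
        exact continuousAt_const.div (hc.mul ((hc.pow 2).sub continuousAt_const).sqrt)
          (by positivity)
      have hd := intervalIntegral.integral_hasDerivAt_right
        (f := kap m ν) (a := t x) (b := t s)
        (hi.mono_set (by
          rw [uIcc_of_le hle, uIcc_of_le (hmaps s ⟨hs'.1.le, hs'.2.le⟩).1]
          exact Icc_subset_Icc_right (hmaps s ⟨hs'.1.le, hs'.2.le⟩).2))
        ((kap_meas hmc ν).stronglyMeasurable.stronglyMeasurableAtFilter) hc
      refine ((g.hθ s).sub (hd.comp s (g.ht s))).congr_deriv ?_
      rw [kap_eq hm, g.Rf_eq, abs_of_pos hps]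
      field_simp
      ring)
  simp only [intervalIntegral.integral_same] at this
  linarith

open MeasureTheory in
theorem piece_ang' (g : Geo m ν t p θ) (hmc : Continuous m) (hm : ∀ t, 0 < m t) (h0 : 0 ≤ ν)
    {x y : ℝ} (hxy : x ≤ y) (hs : ∀ s ∈ Ioo x y, p s < 0)
    (hi : IntervalIntegrable (kap m ν) volume (t y) (t x)) :
    θ y - θ x = ∫ r in (t y)..(t x), kap m ν r := by
  have := g.rev.piece_ang hmc hm h0 (neg_le_neg hxy) (fun s hs' => by
    have := hs (-s) ⟨by linarith [hs'.2], by linarith [hs'.1]⟩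
    simpa using this) (by simpa using hi)
  simp only [neg_neg] at this
  linarith

theorem θmono (g : Geo m ν t p θ) (hm : ∀ t, 0 < m t) (h0 : 0 < ν) : StrictMono θ := by
  apply strictMono_of_deriv_pos
  intro s
  rw [(g.hθ s).deriv]
  have := hm (t s)
  positivity

/-- the curve of a geodesic -/
theorem curve_c1 (g : Geo m ν t p θ) (hmc : Continuous m) (hm : ∀ t, 0 < m t) :
    ContDiff ℝ 1 (fun s => (t s, θ s)) := by
  apply ContDiff.prodMk
  · rw [contDiff_one_iff_deriv]
    refine ⟨fun s => (g.ht s).differentiableAt, ?_⟩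
    rw [show deriv t = p from funext fun s => (g.ht s).deriv]
    exact g.pcont
  · rw [contDiff_one_iff_deriv]
    refine ⟨fun s => (g.hθ s).differentiableAt, ?_⟩
    rw [show deriv θ = fun s => ν / m (t s) ^ 2 from funext fun s => (g.hθ s).deriv]
    exact continuous_const.div ((hmc.comp g.tcont).pow 2) fun s => (pow_pos (hm _) 2).ne'

theorem dist_le0 (g : Geo m ν t p θ) (hmc : Continuous m) (hm : ∀ t, 0 < m t) {y : ℝ}
    (h : 0 ≤ y) : wDist m (t 0, θ 0) (t y, θ y) ≤ y := by
  refine (wDist_le h (g.curve_c1 hmc hm) rfl rfl).trans_eq ?_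
  unfold wLength
  have : ∀ s, √(deriv (fun u => ((fun s => (t s, θ s)) u).1) s ^ 2 +
      m ((fun s => (t s, θ s)) s).1 ^ 2 * deriv (fun u => ((fun s => (t s, θ s)) u).2) s ^ 2) = 1 := by
    intro s
    have e1 : deriv (fun u => t u) s = p s := (g.ht s).deriv
    have e2 : deriv (fun u => θ u) s = ν / m (t s) ^ 2 := (g.hθ s).deriv
    simp only [e1, e2]
    have := hm (t s)
    rw [show m (t s) ^ 2 * (ν / m (t s) ^ 2) ^ 2 = ν ^ 2 / m (t s) ^ 2 by field_simp, g.he s,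
      Real.sqrt_one]
  simp only [this]
  simp

theorem dist_le (g : Geo m ν t p θ) (hmc : Continuous m) (hm : ∀ t, 0 < m t) {x y : ℝ}
    (h : x ≤ y) : wDist m (t x, θ x) (t y, θ y) ≤ y - x := by
  have := (g.shift x).dist_le0 hmc hm (y := y - x) (by linarith)
  simpa using this

theorem sub_min (g : Geo m ν t p θ) (hmc : Continuous m) (hm : ∀ t, 0 < m t) {x a b y : ℝ}
    (h1 : x ≤ a) (h2 : a ≤ b) (h3 : b ≤ y) (h : y - x ≤ wDist m (t x, θ x) (t y, θ y)) :
    wDist m (t a, θ a) (t b, θ b) = b - a := by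
  apply le_antisymm (g.dist_le hmc hm h2)
  have e1 := g.dist_le hmc hm h1
  have e2 := g.dist_le hmc hm h3
  have e3 := wDist_triangle hmc (t x, θ x) (t a, θ a) (t y, θ y)
  have e4 := wDist_triangle hmc (t a, θ a) (t b, θ b) (t y, θ y)
  linarith

end Geo

end

section
open Real Set

theorem exists_clamp {f : ℝ → ℝ} (hf : ContDiff ℝ 1 f) {L : ℝ} (hL : 0 ≤ L) :
    ∃ (F : ℝ → ℝ) (K : NNReal) (B : ℝ), LipschitzWith K F ∧ (∀ x, |F x| ≤ B) ∧
      ∀ x, |x| ≤ L → F x = f x := by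
  have hc : IsCompact (Icc (-L) L) := isCompact_Icc
  obtain ⟨K, hK⟩ := LocallyLipschitzOn.exists_lipschitzOnWith_of_compact hc
    (hf.locallyLipschitz.locallyLipschitzOn (s := Icc (-L) L))
  obtain ⟨B, hB⟩ := hc.exists_bound_of_continuousOn hf.continuous.continuousOn
  have cl : LipschitzWith 1 (fun x : ℝ => max (-L) (min L x)) :=
    (LipschitzWith.id.const_min L).const_max (-L)
  have cm : ∀ x : ℝ, max (-L) (min L x) ∈ Icc (-L) L := fun x =>
    ⟨le_max_left _ _, max_le (by linarith) (min_le_left _ _)⟩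
  refine ⟨fun x => f (max (-L) (min L x)), K * 1, B, ?_, fun x => hB _ (cm x), ?_⟩
  · rw [← lipschitzOnWith_univ] at cl ⊢
    exact hK.comp cl (fun x _ => cm x)
  · intro x hx
    rw [abs_le] at hx
    simp only
    rw [min_eq_right hx.2, max_eq_right hx.1]

namespace Geo
variable {m : ℝ → ℝ} {ν t0 : ℝ} {t p θ : ℝ → ℝ}

theorem F_c1 (h : MH m t0) : ContDiff ℝ 1 fun x => deriv m x / m x ^ 3 :=
  h.cdd.div ((h.cd.of_le (by norm_num)).pow 3) fun x => (pow_pos (h.pos x) 3).ne'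

/-- A geodesic with `t' = 0` at a critical point of `m` is a parallel. -/
theorem const_of_crit (h : MH m t0) (g : Geo m ν t p θ) {s0 : ℝ} (h1 : p s0 = 0)
    (h2 : deriv m (t s0) = 0) (s : ℝ) : p s = 0 := by
  set n := |s - s0| + 1 with hn
  have hn0 : 0 < n := by positivity
  obtain ⟨F, K, B, hF, -, hFe⟩ := exists_clamp (F_c1 h) (L := |t s0| + n) (by positivity)
  set v : ℝ → ℝ × ℝ → ℝ × ℝ := fun _ x => (x.2, ν ^ 2 * F x.1) with hv
  have hF2 : LipschitzWith (‖ν ^ 2‖₊ * K) (fun x : ℝ => ν ^ 2 * F x) := by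
    apply LipschitzWith.of_dist_le_mul
    intro x y
    have := hF.dist_le_mul x y
    rw [Real.dist_eq] at this ⊢
    rw [← mul_sub, abs_mul]
    push_cast
    rw [Real.norm_eq_abs, mul_assoc]
    gcongr
  have hlip : LipschitzWith (max 1 (‖ν ^ 2‖₊ * K * 1)) (v 0) :=
    LipschitzWith.prod_snd.prodMk (hF2.comp LipschitzWith.prod_fst)
  have key := ODE_solution_unique_of_mem_Icc (v := v) (s := fun _ => univ) (a := s0 - n)
    (b := s0 + n) (t₀ := s0) (f := fun s => (t s, p s)) (g := fun _ => (t s0, 0))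
    (fun _ _ => hlip.lipschitzOnWith) ⟨by linarith, by linarith⟩
    (g.tcont.prodMk g.pcont).continuousOn
    (fun s hs => by
      have e : F (t s) = deriv m (t s) / m (t s) ^ 3 := by
        apply hFe
        have a1 := g.t_lip s0 s
        have a2 : |s - s0| ≤ n := by
          rw [abs_le]; constructor <;> linarith [hs.1, hs.2]
        have a3 := abs_sub_abs_le_abs_sub (t s) (t s0)
        linarith
      have := (g.ht s).prodMk (g.hp s)
      rw [← e] at this
      exact this)
    (fun _ _ => mem_univ _) continuousOn_const
    (fun s _ => by
      have e : F (t s0) = 0 := by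
        rw [hFe _ (by linarith), h2, zero_div]
      have : v s (t s0, 0) = 0 := by simp [hv, e]
      rw [this]
      exact hasDerivAt_const _ _)
    (fun _ _ => mem_univ _) (by simp [h1])
  have hs : s ∈ Icc (s0 - n) (s0 + n) := by
    have := abs_le.1 (le_refl |s - s0|)
    constructor <;> linarith [this.1, this.2]
  have := key hs
  exact congrArg Prod.snd this

theorem sign_const (h : MH m t0) (g : Geo m ν t p θ) (h0 : 0 ≤ ν) (h1 : ν ≤ m t0) :
    (∀ s, p s = 0) ∨ (∀ s, 0 < p s) ∨ (∀ s, p s < 0) := by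
  by_cases hz : ∃ s0, p s0 = 0
  · left
    obtain ⟨s0, hs0⟩ := hz
    have e := (g.p_zero_iff h.pos h0 s0).1 hs0
    apply g.const_of_crit h hs0
    have e1 : m (t s0) ≤ m t0 := by linarith
    -- `t s0 = ± t0`
    have e2 : |t s0| = t0 := by
      rw [← h.abs_eq] at e1
      rcases lt_trichotomy |t s0| t0 with c | c | c
      · exact absurd e1 (h.anti ⟨abs_nonneg _, c.le⟩ ⟨h.t0pos.le, le_rfl⟩ c).not_ge
      · exact c
      · exact absurd e1 (h.mono self_mem_Ici c.le c).not_ge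
    rcases abs_choice (t s0) with c | c
    · rw [← c, e2]; exact h.dzero
    · have : t s0 = - t0 := by linarith
      rw [this, deriv_even h.even, h.dzero, neg_zero]
  · right
    push Not at hz
    have ivt : ∀ x y, p x < 0 → 0 < p y → False := by
      intro x y hx hy
      obtain ⟨z, hz'⟩ := mem_range_of_exists_le_of_exists_ge g.pcont ⟨x, hx.le⟩ ⟨y, hy.le⟩
      exact hz z hz'
    rcases lt_or_gt_of_ne (hz 0) with c | c
    · right
      intro s
      rcases lt_or_gt_of_ne (hz s) with d | d
      · exact d
      · exact (ivt 0 s c d).elim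
    · left
      intro s
      rcases lt_or_gt_of_ne (hz s) with d | d
      · exact (ivt s 0 d c).elim
      · exact d

/-- Core, small Clairaut constant. -/
theorem core1 (h : MH m t0) (g : Geo m ν t p θ) (h0 : 0 ≤ ν) (h1 : ν ≤ m t0) {a : ℝ}
    (ha : 0 ≤ a) : wDist m (t 0, θ 0) (t a, θ a) = a := by
  apply le_antisymm (g.dist_le0 h.cont h.pos ha)
  apply le_wDist
  intro c b hb hc hc0 hcb
  have cal := calib_curve h.cont h.pos h0 hc le_rfl hb (fun s _ => h1.trans (h.min_le _))
  rw [hc0, hcb] at cal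
  simp only [intervalIntegral.integral_same, abs_zero, add_zero] at cal
  have hs : (∀ s ∈ Ioo 0 a, 0 ≤ p s) ∨ (∀ s ∈ Ioo 0 a, p s ≤ 0) := by
    rcases g.sign_const h h0 h1 with c | c | c
    · exact Or.inl fun s _ => (c s).ge
    · exact Or.inl fun s _ => (c s).le
    · exact Or.inr fun s _ => (c s).le
  rcases hs with hs | hs
  · have := g.piece_len h.cont h.pos ha hs
    linarith [le_abs_self (∫ r in (t 0)..(t a), Rf m ν r)]
  · have := g.piece_len' h.cont h.pos ha hs
    rw [intervalIntegral.integral_symm] at this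
    linarith [neg_le_abs (∫ r in (t 0)..(t a), Rf m ν r)]

/-- first zero after an initial stretch of negativity -/
theorem first_zero {f : ℝ → ℝ} (hf : Continuous f) {x : ℝ} (hneg : ∃ δ > 0, ∀ s ∈ Ioo x (x + δ), f s < 0)
    (hz : ∃ y > x, 0 ≤ f y) : ∃ e > x, f e = 0 ∧ ∀ s ∈ Ioo x e, f s < 0 := by
  obtain ⟨δ, hδ, hn⟩ := hneg
  obtain ⟨y, hy, hfy⟩ := hz
  have hyδ : x + δ ≤ y := by
    by_contra hc
    push Not at hc
    exact absurd (hn y ⟨hy, hc⟩) hfy.not_gt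
  set S := {s | x + δ ≤ s ∧ 0 ≤ f s} with hS
  have hcl : IsClosed S :=
    (isClosed_le continuous_const continuous_id).inter (isClosed_le continuous_const hf)
  have hne : S.Nonempty := ⟨y, hyδ, hfy⟩
  have hbd : BddBelow S := ⟨x + δ, fun s hs => hs.1⟩
  have hmem := hcl.csInf_mem hne hbd
  set e := sInf S
  have hxe : x < e := by linarith [hmem.1]
  have hlt : ∀ s ∈ Ioo x e, f s < 0 := by
    intro s hs
    by_contra hc
    push Not at hc
    rcases lt_or_ge s (x + δ) with d | d
    · exact absurd (hn s ⟨hs.1, d⟩) hc.not_gt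
    · exact absurd (csInf_le hbd ⟨d, hc⟩) hs.2.not_ge
  refine ⟨e, hxe, le_antisymm ?_ hmem.2, hlt⟩
  have : e ∈ closure (Ioo x e) := by
    rw [closure_Ioo hxe.ne]; exact ⟨hxe.le, le_rfl⟩
  have h2 : closure (Ioo x e) ⊆ {s | f s ≤ 0} :=
    closure_minimal (fun s hs => (hlt s hs).le) (isClosed_le hf continuous_const)
  exact h2 this

/-- Bounded-duration lemma: a decreasing stretch in a region where `κ` is integrable ends. -/
theorem exists_nonneg (g : Geo m ν t p θ) (hmc : Continuous m) (hm : ∀ t, 0 < m t) (h0 : 0 ≤ ν)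
    {A B x : ℝ} (hi : IntervalIntegrable (kap m ν) MeasureTheory.volume A B)
    (hr : ∀ s, x ≤ s → (t s) ∈ Icc A B) : ∃ y > x, 0 ≤ p y := by
  by_contra hc
  push Not at hc
  have hAB : A ≤ B := (hr x le_rfl).1.trans (hr x le_rfl).2
  have hR := Rf_cont hmc hm ν
  set C := ν * (∫ r in A..B, kap m ν r) + ∫ r in A..B, Rf m ν r with hC
  have bd : ∀ y, x < y → y - x ≤ C := by
    intro y hy
    have hxm := hr x le_rfl
    have hym := hr y hy.le
    have hanti : AntitoneOn t (Icc x y) := by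
      apply antitoneOn_of_deriv_nonpos (convex_Icc x y) g.tcont.continuousOn
        (fun s _ => (g.ht s).differentiableAt.differentiableWithinAt)
      intro s hs
      rw [interior_Icc] at hs
      rw [(g.ht s).deriv]; exact (hc s hs.1).le
    have hle : t y ≤ t x := hanti ⟨le_rfl, hy.le⟩ ⟨hy.le, le_rfl⟩ hy.le
    have e1 := g.piece_len' hmc hm hy.le (fun s hs => (hc s hs.1).le)
    have e2 := g.piece_ang' hmc hm h0 hy.le (fun s hs => hc s hs.1) (hi.mono_set (by
      rw [uIcc_of_le hAB, uIcc_of_le hle]; exact Icc_subset_Icc hym.1 hxm.2))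
    have e3 : ∫ r in (t y)..(t x), kap m ν r ≤ ∫ r in A..B, kap m ν r :=
      intervalIntegral.integral_mono_interval hym.1 hle hxm.2
        (Filter.Eventually.of_forall fun r => kap_nonneg hm h0) hi
    have e4 : ∫ r in (t y)..(t x), Rf m ν r ≤ ∫ r in A..B, Rf m ν r :=
      intervalIntegral.integral_mono_interval hym.1 hle hxm.2
        (Filter.Eventually.of_forall fun r => Rf_nonneg _ _ _) (hR.intervalIntegrable _ _)
    rw [e1, e2, hC]
    have := mul_le_mul_of_nonneg_left e3 h0
    linarith
  have := bd (x + (|C| + 1)) (by linarith [abs_nonneg C])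
  linarith [le_abs_self C]

end Geo

end

section
open Real Set

namespace Geo
variable {m : ℝ → ℝ} {ν t0 : ℝ} {t p θ : ℝ → ℝ}

theorem A_gt (h : MH m t0) (g : Geo m ν t p θ) (h1 : m t0 < ν) (h2 : t0 ≤ t 0) (s : ℝ) :
    t0 < t s := by
  by_contra hc
  push Not at hc
  obtain ⟨z, hz⟩ := mem_range_of_exists_le_of_exists_ge g.tcont ⟨s, hc⟩ ⟨0, h2⟩
  have := g.ν_le h.pos z
  rw [hz] at this
  linarith

theorem A_pmono (h : MH m t0) (g : Geo m ν t p θ) (h1 : m t0 < ν) (h2 : t0 ≤ t 0) :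
    StrictMono p := by
  apply strictMono_of_deriv_pos
  intro s
  rw [(g.hp s).deriv]
  have a := h.pos (t s)
  have b := h.dpos _ (g.A_gt h h1 h2 s)
  have c := (h.pos t0).trans h1
  positivity

theorem A_nonneg (h : MH m t0) (g : Geo m ν t p θ) (h1 : m t0 < ν) (h2 : t0 ≤ t 0) :
    ∃ y, 0 ≤ p y := by
  by_contra hc
  push Not at hc
  have hanti : Antitone t := by
    apply antitone_of_deriv_nonpos (fun s => (g.ht s).differentiableAt)
    intro s
    rw [(g.ht s).deriv]; exact (hc s).le
  obtain ⟨y, -, hy⟩ := g.exists_nonneg h.cont h.pos ((h.pos t0).trans h1).le (x := 0)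
    (h.A_kap_int h2 h1 (g.ν_le h.pos 0)) (fun s hs => ⟨(g.A_gt h h1 h2 s).le, hanti hs⟩)
  exact absurd (hc y) hy.not_gt

theorem A_turn (h : MH m t0) (g : Geo m ν t p θ) (h1 : m t0 < ν) (h2 : t0 ≤ t 0) :
    ∃ s, p s = 0 := by
  obtain ⟨y, hy⟩ := g.A_nonneg h h1 h2
  obtain ⟨z, hz⟩ := g.rev.A_nonneg h h1 (by simpa using h2)
  exact mem_range_of_exists_le_of_exists_ge g.pcont ⟨-z, by linarith⟩ ⟨y, hy⟩

theorem A_curve (h : MH m t0) {c : ℝ → ℝ × ℝ} {b : ℝ} (hb : 0 ≤ b) (hc : Continuous c)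
    (h0 : t0 ≤ (c 0).1) : ∃ s ∈ Icc 0 b, t0 ≤ (c s).1 ∧
      ∀ s' ∈ Icc 0 b, m (c s).1 ≤ m (c s').1 := by
  have hc1 : Continuous fun s => (c s).1 := continuous_fst.comp hc
  obtain ⟨s, hs, hmin⟩ := isCompact_Icc.exists_isMinOn (nonempty_Icc.2 hb) hc1.continuousOn
  rcases le_or_gt t0 (c s).1 with d | d
  · exact ⟨s, hs, d, fun s' hs' => h.mono.monotoneOn d (d.trans (hmin hs')) (hmin hs')⟩
  · obtain ⟨z, hz, e⟩ := intermediate_value_Icc' hs.1 hc1.continuousOn ⟨d.le, h0⟩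
    simp only at e
    refine ⟨z, ⟨hz.1, hz.2.trans hs.2⟩, e.ge, fun s' _ => ?_⟩
    rw [e]; exact h.min_le _

theorem coreA (h : MH m t0) (g : Geo m ν t p θ) (h1 : m t0 < ν) (h2 : t0 ≤ t 0) {a : ℝ}
    (ha : 0 ≤ a) : wDist m (t 0, θ 0) (t a, θ a) = a := by
  have hν := (h.pos t0).trans h1
  obtain ⟨s1, hs1⟩ := g.A_turn h h1 h2
  have hpm := g.A_pmono h h1 h2
  have hgt := fun s => (g.A_gt h h1 h2 s).le
  have hνm := g.ν_le h.pos
  have hR := fun ν => Rf_cont h.cont h.pos ν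
  set x := min 0 s1 with hx
  set y := max a s1 with hy
  have hxs : x ≤ s1 := min_le_right _ _
  have hsy : s1 ≤ y := le_max_right _ _
  have em := (g.p_zero_iff h.pos hν.le s1).1 hs1
  have ki : ∀ s, IntervalIntegrable (fun r => kap m ν r) MeasureTheory.volume t0 (t s) := fun s =>
    h.A_kap_int (hgt s) h1 (hνm s)
  have kz : ∀ r ∈ uIcc t0 (t s1), m r ≤ ν := by
    intro r hr
    rw [uIcc_of_le (hgt s1)] at hr
    rw [← em]
    exact h.mono.monotoneOn hr.1 (hgt s1) hr.2
  have k2 : ∀ s, IntervalIntegrable (fun r => kap m ν r) MeasureTheory.volume (t s1) (t s) :=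
    fun s => (ki s1).symm.trans (ki s)
  have ek := fun s => (MH.ext_zero' (k2 s) fun r hr => kap_zero h.pos (kz r hr)).2
  have eR := fun s => (MH.ext_zero' ((hR ν).intervalIntegrable (t s1) (t s))
    fun r hr => Rf_zero h.pos (kz r hr)).2
  have l1 := g.piece_len h.cont h.pos hsy (fun s hs => by
    rw [← hs1]; exact (hpm hs.1).le)
  have l2 := g.piece_len' h.cont h.pos hxs (fun s hs => by
    rw [← hs1]; exact (hpm hs.2).le)
  have n1 := g.piece_ang h.cont h.pos hν.le hsy (fun s hs => by
    rw [← hs1]; exact (hpm hs.1)) (k2 y)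
  have n2 := g.piece_ang' h.cont h.pos hν.le hxs (fun s hs => by
    rw [← hs1]; exact (hpm hs.2)) (k2 x)
  rw [← eR] at l1 l2
  rw [← ek] at n1 n2
  have key : y - x ≤ wDist m (t x, θ x) (t y, θ y) := by
    apply le_wDist
    intro c b hb hc hc0 hcb
    obtain ⟨s, hs, d, hle⟩ := A_curve h hb hc.continuous (by rw [hc0]; exact hgt x)
    set ν' := m (c s).1 with hν'
    have cal := calib_curve h.cont h.pos (h.pos _).le hc hs.1 hs.2 hle
    rw [hc0, hcb] at cal
    have b0 := hle 0 ⟨le_rfl, hb⟩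
    have b1 := hle b ⟨hb, le_rfl⟩
    rw [hc0] at b0
    rw [hcb] at b1
    have rz : ∀ r ∈ uIcc t0 (c s).1, Rf m ν' r = 0 := by
      intro r hr
      rw [uIcc_of_le d] at hr
      exact Rf_zero h.pos (h.mono.monotoneOn hr.1 d hr.2)
    have eR' := fun z => (MH.ext_zero' ((hR ν').intervalIntegrable (c s).1 z) rz).2
    have q1 := h.A_ineq (hgt x) (h.min_le (c s).1) b0 h1 (hνm x)
    have q2 := h.A_ineq (hgt y) (h.min_le (c s).1) b1 h1 (hνm y)
    rw [eR', ← hν'] at q1 q2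
    simp only at cal
    have c1 := le_abs_self (∫ r in (c s).1..(t y), Rf m ν' r)
    have c2 := neg_le_abs (∫ r in (t x)..(c s).1, Rf m ν' r)
    have c3 := intervalIntegral.integral_symm (f := Rf m ν') (μ := MeasureTheory.volume) (t x) (c s).1
    have e : θ y - θ x = (∫ r in t0..(t y), kap m ν r) + ∫ r in t0..(t x), kap m ν r := by
      linarith
    have e2 : y - x = ν * (θ y - θ x) + (∫ r in t0..(t y), Rf m ν r) + ∫ r in t0..(t x), Rf m ν r := by
      linarith
    rw [e2, e]
    rw [e, ← hν'] at cal
    linarith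
  have := g.sub_min h.cont h.pos (min_le_left 0 s1) ha (le_max_left a s1) key
  linarith

end Geo

end

section
open Real Set

theorem kap_even {m : ℝ → ℝ} (he : ∀ t, m (-t) = m t) (ν r : ℝ) : kap m ν (-r) = kap m ν r := by
  unfold kap; rw [he]
theorem Rf_even {m : ℝ → ℝ} (he : ∀ t, m (-t) = m t) (ν r : ℝ) : Rf m ν (-r) = Rf m ν r := by
  unfold Rf; rw [he]

section osc
open MeasureTheory
variable {f : ℝ → ℝ} {t0 : ℝ}

theorem int_odd (he : ∀ r, f (-r) = f r) (v : ℝ) :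
    ∫ r in (0:ℝ)..(-v), f r = - ∫ r in (0:ℝ)..v, f r := by
  have := intervalIntegral.integral_comp_neg (f := f) (a := 0) (b := v)
  simp only [he, neg_zero] at this
  rw [this, intervalIntegral.integral_symm]

theorem int_sym (he : ∀ r, f (-r) = f r) (h0 : 0 ≤ t0) (hi : IntervalIntegrable f volume 0 t0) :
    IntervalIntegrable f volume (-t0) t0 := by
  have h1 : IntervalIntegrable f volume (-t0) 0 := by
    have := (IntervalIntegrable.iff_comp_neg (by simp)).1 hi
    simp only [he, neg_zero] at this
    exact this.symm
  exact h1.trans hi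

theorem osc_abs (_he : ∀ r, f (-r) = f r) (hi : IntervalIntegrable f volume 0 t0) {w : ℝ}
    (hw : |w| ≤ t0) (hz : ∀ r ∈ Icc |w| t0, f r = 0) :
    ∫ r in (0:ℝ)..|w|, f r = ∫ r in (0:ℝ)..t0, f r := by
  refine (MH.ext_zero (hi.mono_set ?_) ?_).2.symm
  · rw [uIcc_of_le (abs_nonneg w), uIcc_of_le ((abs_nonneg w).trans hw)]
    exact Icc_subset_Icc_right hw
  · rw [uIcc_of_le hw]; exact hz

theorem int_split (hi : IntervalIntegrable f volume (-t0) t0) (h0 : 0 ≤ t0) {a b : ℝ}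
    (ha : |a| ≤ t0) (hb : |b| ≤ t0) :
    ∫ r in a..b, f r = (∫ r in (0:ℝ)..b, f r) - ∫ r in (0:ℝ)..a, f r := by
  have k : ∀ z, |z| ≤ t0 → IntervalIntegrable f volume 0 z := by
    intro z hz
    rw [abs_le] at hz
    apply hi.mono_set
    rw [uIcc_of_le (by linarith : -t0 ≤ t0)]
    exact uIcc_subset_Icc ⟨by linarith, h0⟩ hz
  rw [intervalIntegral.integral_interval_sub_left (k b hb) (k a ha)]

end osc

namespace Geo
variable {m : ℝ → ℝ} {ν t0 : ℝ} {t p θ : ℝ → ℝ}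

theorem B_lt (h : MH m t0) (g : Geo m ν t p θ) (h1 : m t0 < ν) (h2 : |t 0| < t0) (s : ℝ) :
    |t s| < t0 := by
  by_contra hc
  push Not at hc
  obtain ⟨z, hz⟩ := mem_range_of_exists_le_of_exists_ge g.tcont.abs ⟨0, h2.le⟩ ⟨s, hc⟩
  have := g.ν_le h.pos z
  simp only at hz
  rw [← h.abs_eq, hz] at this
  linarith

theorem descend (h : MH m t0) (g : Geo m ν t p θ) (h1 : m t0 < ν) (h1' : ν < m 0)
    (h2 : ∀ s, |t s| < t0) (x : ℝ) (h3 : p x < 0 ∨ p x = 0 ∧ 0 < t x) :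
    ∃ e > x, p e = 0 ∧ t e < 0 ∧ ∀ s ∈ Ioo x e, p s < 0 := by
  have hν := (h.pos t0).trans h1
  have ki := int_sym (kap_even h.even ν) h.t0pos.le (h.B_kap_int h1 h1')
  have hz := g.exists_nonneg h.cont h.pos hν.le (x := x) ki (fun s _ => abs_le.1 (h2 s).le)
  have hneg : ∃ δ > 0, ∀ s ∈ Ioo x (x + δ), p s < 0 := by
    have : ∀ᶠ s in nhdsWithin x (Ioi x), p s < 0 := by
      rcases h3 with c | ⟨c, d⟩
      · exact (g.pcont.continuousAt.eventually_lt continuousAt_const c).filter_mono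
          nhdsWithin_le_nhds
      · have hd : deriv m (t x) < 0 := h.dneg _ d (lt_of_abs_lt (h2 x))
        have hm := h.pos (t x)
        have hd' : ν ^ 2 * (deriv m (t x) / m (t x) ^ 3) < 0 :=
          mul_neg_of_pos_of_neg (by positivity) (div_neg_of_neg_of_pos hd (by positivity))
        have := hasDerivAt_iff_tendsto_slope.1 (g.hp x)
        have := (this.eventually_lt_const hd').filter_mono
          (nhdsWithin_mono x (fun y (hy : x < y) => hy.ne'))
        filter_upwards [this, self_mem_nhdsWithin] with s hs hxs
        rw [slope_def_field, c, sub_zero] at hs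
        have hxs : x < s := hxs
        by_contra hc
        push Not at hc
        have : 0 ≤ p s / (s - x) := div_nonneg hc (by linarith)
        linarith
    obtain ⟨u, hu, hu2⟩ := mem_nhdsGT_iff_exists_Ioo_subset.1 this
    exact ⟨u - x, by linarith [show x < u from hu], fun s hs => hu2 ⟨hs.1, by linarith [hs.2]⟩⟩
  obtain ⟨e, he, e0, en⟩ := first_zero g.pcont hneg hz
  refine ⟨e, he, e0, ?_, en⟩
  by_contra hc
  push Not at hc
  have hme := (g.p_zero_iff h.pos hν.le e).1 e0
  have ht : 0 < t e := lt_of_le_of_ne hc (by rintro hh; rw [← hh] at hme; linarith)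
  have hd : deriv m (t e) < 0 := h.dneg _ ht (lt_of_abs_lt (h2 e))
  have hm := h.pos (t e)
  have hd' : ν ^ 2 * (deriv m (t e) / m (t e) ^ 3) < 0 :=
    mul_neg_of_pos_of_neg (by positivity) (div_neg_of_neg_of_pos hd (by positivity))
  have := hasDerivAt_iff_tendsto_slope.1 (g.hp e)
  have := (this.eventually_lt_const hd').filter_mono
    (nhdsWithin_mono e (show Iio e ⊆ {e}ᶜ from fun y (hy : y < e) => hy.ne))
  have h5 : ∀ᶠ s in nhdsWithin e (Iio e), s ∈ Ioo x e := Ioo_mem_nhdsLT he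
  obtain ⟨s, hs, hs2⟩ := (this.and h5).exists
  rw [slope_def_field, e0, sub_zero] at hs
  have : 0 < p s / (s - e) := div_pos_of_neg_of_neg (en s hs2) (by linarith [hs2.2])
  linarith

theorem half_osc (h : MH m t0) (g : Geo m ν t p θ) (h1 : m t0 < ν) (h1' : ν < m 0)
    (h2 : ∀ s, |t s| < t0) (h3 : p 0 < 0 ∨ p 0 = 0 ∧ 0 < t 0) :
    ∃ y > 0, t y = - t 0 ∧ θ y - θ 0 = 2 * (∫ r in (0:ℝ)..t0, kap m ν r) ∧
      y = ν * (2 * (∫ r in (0:ℝ)..t0, kap m ν r)) + 2 * (∫ r in (0:ℝ)..t0, Rf m ν r) := by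
  have hν := (h.pos t0).trans h1
  have t0p := h.t0pos.le
  have ki0 := h.B_kap_int h1 h1'
  have ki := int_sym (kap_even h.even ν) h.t0pos.le ki0
  have hR := Rf_cont h.cont h.pos ν
  obtain ⟨e, he, e0, et, en⟩ := g.descend h h1 h1' h2 0 h3
  have hme := (g.p_zero_iff h.pos hν.le e).1 e0
  obtain ⟨e2, he2, e20, e2t, e2n⟩ := (g.negt h.even).descend h h1 h1' (by simpa using h2) e
    (Or.inr ⟨by simp [e0], by linarith⟩)
  have hme2 := (g.p_zero_iff h.pos hν.le e2).1 (by linarith)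
  have hz : ∀ r ∈ Icc |t e| t0, m r ≤ ν := by
    intro r hr
    rw [← hme]
    apply h.le_of_abs
    · rw [abs_of_nonneg ((abs_nonneg _).trans hr.1)]; exact hr.1
    · rw [abs_of_nonneg ((abs_nonneg _).trans hr.1)]; exact hr.2
  have absle : ∀ e, m (t e) = ν → |t 0| ≤ |t e| := by
    intro e hme
    by_contra hc
    push Not at hc
    have := h.lt_of_abs hc (h2 0).le
    have := g.ν_le h.pos 0
    linarith
  have b1 := absle e hme
  have b2 := absle e2 hme2
  rw [abs_of_neg et] at b1
  rw [abs_of_pos (neg_neg_iff_pos.1 e2t)] at b2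
  rw [abs_le] at b1 b2
  obtain ⟨y, hy, ey⟩ := intermediate_value_Icc he2.le g.tcont.continuousOn
    (show - t 0 ∈ Icc (t e) (t e2) from ⟨by linarith, by linarith⟩)
  have kj : ∀ a b, |a| ≤ t0 → |b| ≤ t0 → IntervalIntegrable (kap m ν) MeasureTheory.volume a b := by
    intro a b ha hb
    apply ki.mono_set
    rw [uIcc_of_le (by linarith : -t0 ≤ t0)]
    exact uIcc_subset_Icc (abs_le.1 ha) (abs_le.1 hb)
  have l1 := g.piece_len' h.cont h.pos he.le (fun s hs => (en s hs).le)
  have l2 := g.piece_len h.cont h.pos hy.1 (fun s hs => by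
    have := e2n s ⟨hs.1, hs.2.trans_le hy.2⟩
    linarith)
  have n1 := g.piece_ang' h.cont h.pos hν.le he.le en (kj _ _ (h2 e).le (h2 0).le)
  have n2 := g.piece_ang h.cont h.pos hν.le hy.1 (fun s hs => by
    have := e2n s ⟨hs.1, hs.2.trans_le hy.2⟩
    linarith) (kj _ _ (h2 e).le (h2 y).le)
  have Ri := hR.intervalIntegrable (μ := MeasureTheory.volume)
  rw [int_split (Ri _ _) t0p (h2 e).le (h2 0).le] at l1
  rw [int_split (Ri _ _) t0p (h2 e).le (h2 y).le, ey, int_odd (Rf_even h.even ν)] at l2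
  rw [int_split ki t0p (h2 e).le (h2 0).le] at n1
  rw [int_split ki t0p (h2 e).le (h2 y).le, ey, int_odd (kap_even h.even ν)] at n2
  have q1 := osc_abs (kap_even h.even ν) ki0 (h2 e).le (fun r hr => kap_zero h.pos (hz r hr))
  have q2 := osc_abs (Rf_even h.even ν) (Ri _ _) (h2 e).le (fun r hr => Rf_zero h.pos (hz r hr))
  rw [abs_of_neg et, int_odd (kap_even h.even ν)] at q1
  rw [abs_of_neg et, int_odd (Rf_even h.even ν)] at q2
  have n : θ y - θ 0 = 2 * ∫ r in (0:ℝ)..t0, kap m ν r := by linarith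
  refine ⟨y, by linarith [hy.1], ey, n, ?_⟩
  rw [← n]
  linarith

theorem half_osc' (h : MH m t0) (g : Geo m ν t p θ) (h1 : m t0 < ν) (h1' : ν < m 0)
    (h2 : ∀ s, |t s| < t0) (h3 : 0 < t 0) :
    ∃ y > 0, t y = - t 0 ∧ θ y - θ 0 = 2 * (∫ r in (0:ℝ)..t0, kap m ν r) ∧
      y = ν * (2 * (∫ r in (0:ℝ)..t0, kap m ν r)) + 2 * (∫ r in (0:ℝ)..t0, Rf m ν r) := by
  rcases lt_trichotomy (p 0) 0 with c | c | c
  · exact g.half_osc h h1 h1' h2 (Or.inl c)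
  · exact g.half_osc h h1 h1' h2 (Or.inr ⟨c, h3⟩)
  · obtain ⟨y, a1, a2, a3⟩ := (g.negt h.even).half_osc h h1 h1' (by simpa using h2)
      (Or.inl (by linarith))
    exact ⟨y, a1, by linarith, a3⟩

theorem B_curve (h : MH m t0) {c : ℝ → ℝ × ℝ} {b : ℝ} (hb : 0 ≤ b) (hc : Continuous c)
    (h0 : |(c 0).1| ≤ t0) : ∃ s ∈ Icc 0 b, |(c 0).1| ≤ |(c s).1| ∧ |(c s).1| ≤ t0 ∧
      ∀ s' ∈ Icc 0 b, m (c s).1 ≤ m (c s').1 := by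
  have hc1 : Continuous fun s => |(c s).1| := (continuous_fst.comp hc).abs
  obtain ⟨s, hs, hmax⟩ := isCompact_Icc.exists_isMaxOn (nonempty_Icc.2 hb) hc1.continuousOn
  rcases le_or_gt |(c s).1| t0 with d | d
  · exact ⟨s, hs, hmax ⟨le_rfl, hb⟩, d, fun s' hs' => h.le_of_abs (hmax hs') d⟩
  · obtain ⟨z, hz, e⟩ := intermediate_value_Icc hs.1 hc1.continuousOn ⟨h0, d.le⟩
    simp only at e
    refine ⟨z, ⟨hz.1, hz.2.trans hs.2⟩, by rw [e]; exact h0, e.le, fun s' _ => ?_⟩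
    rw [← h.abs_eq, e]; exact h.min_le _

theorem phi_eq (h : MH m t0) {u : ℝ} (h0 : 0 < u) (h1 : u < t0) :
    phi m (m u) = 2 * ∫ r in (0:ℝ)..t0, kap m (m u) r := by
  have hx : xi m (m u) = u := by
    unfold xi
    apply IsLeast.csInf_eq
    refine ⟨⟨h0, rfl⟩, ?_⟩
    rintro r ⟨hr, e⟩
    by_contra hc
    push Not at hc
    exact (h.anti ⟨hr.le, by linarith⟩ ⟨h0.le, h1.le⟩ hc).ne' e
  unfold phi
  rw [hx]
  have ki := h.B_kap_int (h.anti ⟨h0.le, h1.le⟩ ⟨h.t0pos.le, le_rfl⟩ h1)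
    (h.anti ⟨le_rfl, h.t0pos.le⟩ ⟨h0.le, h1.le⟩ h0)
  have := osc_abs (w := u) (kap_even h.even (m u)) ki (by rw [abs_of_pos h0]; exact h1.le)
    (fun r hr => by
      rw [abs_of_pos h0] at hr
      exact kap_zero h.pos (h.anti.antitoneOn ⟨h0.le, h1.le⟩ ⟨h0.le.trans hr.1, hr.2⟩ hr.1))
  rw [abs_of_pos h0] at this
  rw [← this]
  rfl

theorem coreB (h : MH m t0) (g : Geo m ν t p θ) (h1 : m t0 < ν) (h2 : 0 < t 0) (h3 : t 0 < t0)
    (hphi : π ≤ phi m (m (t 0))) {a : ℝ} (hθ : θ a - θ 0 ≤ π)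
    (ha : 0 ≤ a) : wDist m (t 0, θ 0) (t a, θ a) = a := by
  have hν := (h.pos t0).trans h1
  have t0p := h.t0pos.le
  have hu : m (t 0) < m 0 := h.anti ⟨le_rfl, h.t0pos.le⟩ ⟨h2.le, h3.le⟩ h2
  have hu' := g.ν_le h.pos 0
  have h1' : ν < m 0 := by linarith
  have habs := g.B_lt h h1 (by rw [abs_of_pos h2]; exact h3)
  obtain ⟨y, y0, ey, ya, yl⟩ := g.half_osc' h h1 h1' habs h2
  have hay : a ≤ y := by
    rw [phi_eq h h2 h3] at hphi
    have := h.B_mono h1 hu' hu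
    by_contra hc
    push Not at hc
    have := g.θmono h.pos hν hc
    linarith
  have key : y - 0 ≤ wDist m (t 0, θ 0) (t y, θ y) := by
    apply le_wDist
    intro c b hb hc hc0 hcb
    obtain ⟨s, hs, d1, d2, hle⟩ := B_curve h hb hc.continuous (by rw [hc0]; exact (habs 0).le)
    rw [hc0] at d1
    simp only at d1
    rw [abs_of_pos h2] at d1
    set ν' := m (c s).1 with hν'
    have Re := Rf_even h.even ν'
    have Ri := (Rf_cont h.cont h.pos ν').intervalIntegrable (μ := MeasureTheory.volume)
    have cal := calib_curve h.cont h.pos (h.pos _).le hc hs.1 hs.2 hle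
    rw [hc0, hcb] at cal
    simp only at cal
    have hlt : ν' < m 0 := h.lt_of_abs (by rw [abs_zero]; linarith) d2
    have q := h.B_ineq (h.min_le (c s).1) hlt h1 h1'
    have eabs := osc_abs (f := Rf m ν') (w := (c s).1) Re (Ri _ _) d2 (fun r hr => by
      apply Rf_zero h.pos
      have r0 := (abs_nonneg _).trans hr.1
      apply h.le_of_abs
      · rw [abs_of_nonneg r0]; exact hr.1
      · rw [abs_of_nonneg r0]; exact hr.2)
    have eabs' : ∫ r in (0:ℝ)..t0, Rf m ν' r ≤ |∫ r in (0:ℝ)..(c s).1, Rf m ν' r| := by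
      rw [← eabs]
      rcases abs_choice (c s).1 with k | k
      · rw [k]; exact le_abs_self _
      · rw [k, int_odd Re]; exact neg_le_abs _
    rw [← hν', int_split (Ri _ _) t0p (habs 0).le d2, ey, int_split (Ri _ _) t0p d2
      (by rw [abs_neg]; exact (habs 0).le), int_odd Re, ya] at cal
    rw [← hν'] at q
    set W := ∫ r in (0:ℝ)..(c s).1, Rf m ν' r
    set U := ∫ r in (0:ℝ)..(t 0), Rf m ν' r
    have tri : 2 * |W| ≤ |W - U| + |-U - W| := by
      have := abs_sub (W - U) (-U - W)
      rw [show W - U - (-U - W) = 2 * W by ring, abs_mul, abs_two] at this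
      exact this
    rw [sub_zero, yl]
    linarith
  have := g.sub_min h.cont h.pos le_rfl ha hay key
  linarith

/-- The full minimality statement. -/
theorem core (h : MH m t0) (g : Geo m ν t p θ) (h2 : 0 < t 0)
    (hcase : t 0 < t0 → π ≤ phi m (m (t 0))) {a : ℝ} (hθ : |θ a - θ 0| ≤ π)
    (ha : 0 ≤ a) : wDist m (t 0, θ 0) (t a, θ a) = a := by
  have main : ∀ {ν : ℝ} {θ : ℝ → ℝ}, Geo m ν t p θ → 0 ≤ ν → |θ a - θ 0| ≤ π →
      wDist m (t 0, θ 0) (t a, θ a) = a := by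
    intro ν θ g hν hθ
    rcases le_or_gt ν (m t0) with c | c
    · exact g.core1 h hν c ha
    · rcases lt_or_ge (t 0) t0 with d | d
      · exact g.coreB h c h2 d (hcase d) (abs_le.1 hθ).2 ha
      · exact g.coreA h c d ha
  rcases le_total 0 ν with c | c
  · exact main g c hθ
  · have := main g.negθ (by linarith) (by rw [show -θ a - -θ 0 = -(θ a - θ 0) by ring, abs_neg]; exact hθ)
    apply le_antisymm (g.dist_le0 h.cont h.pos ha)
    have := wDist_map h.cont 1 (-1) 0 (by norm_num) (by norm_num) (by simp) (t 0, θ 0) (t a, θ a)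
    simp at this
    linarith

end Geo

end

section
open Real Set

/-- The geodesic vector field in angular form. -/
def gV (m : ℝ → ℝ) (x : ℝ × ℝ × ℝ) : ℝ × ℝ × ℝ :=
  (cos x.2.1, -(sin x.2.1 * (deriv m x.1 / m x.1)), sin x.2.1 * (1 / m x.1))

theorem hd_fst {F G : Type*} [NormedAddCommGroup F] [NormedSpace ℝ F] [NormedAddCommGroup G]
    [NormedSpace ℝ G] {x : ℝ → F × G} {v : F × G} {s : ℝ} (h : HasDerivAt x v s) :
    HasDerivAt (fun s => (x s).1) v.1 s :=
  (ContinuousLinearMap.fst ℝ F G).hasFDerivAt.comp_hasDerivAt s h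

theorem hd_snd {F G : Type*} [NormedAddCommGroup F] [NormedSpace ℝ F] [NormedAddCommGroup G]
    [NormedSpace ℝ G] {x : ℝ → F × G} {v : F × G} {s : ℝ} (h : HasDerivAt x v s) :
    HasDerivAt (fun s => (x s).2) v.2 s :=
  (ContinuousLinearMap.snd ℝ F G).hasFDerivAt.comp_hasDerivAt s h

theorem lip_sin_mul {F : ℝ → ℝ} {K : NNReal} {B : ℝ} (hF : LipschitzWith K F) (hB : ∀ x, |F x| ≤ B) :
    LipschitzWith (Real.toNNReal B + K) (fun x : ℝ × ℝ × ℝ => sin x.2.1 * F x.1) := by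
  apply LipschitzWith.of_dist_le_mul
  intro x y
  have hB0 : 0 ≤ B := (abs_nonneg _).trans (hB 0)
  have h1 := hF.dist_le_mul x.1 y.1
  have d1 : dist x.1 y.1 ≤ dist x y := le_max_left _ _
  have d2 : dist x.2.1 y.2.1 ≤ dist x y :=
    (le_max_left (dist x.2.1 y.2.1) (dist x.2.2 y.2.2)).trans (le_max_right _ _)
  have h2 : |sin x.2.1 - sin y.2.1| ≤ dist x.2.1 y.2.1 := by
    have := Real.lipschitzWith_sin.dist_le_mul x.2.1 y.2.1
    simpa [Real.dist_eq] using this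
  rw [Real.dist_eq] at h1 ⊢
  rw [show sin x.2.1 * F x.1 - sin y.2.1 * F y.1 =
    (sin x.2.1 - sin y.2.1) * F x.1 + sin y.2.1 * (F x.1 - F y.1) by ring]
  have h3 : |(sin x.2.1 - sin y.2.1) * F x.1| ≤ dist x y * B := by
    rw [abs_mul]
    exact mul_le_mul (h2.trans d2) (hB _) (abs_nonneg _) dist_nonneg
  have h4 : |sin y.2.1 * (F x.1 - F y.1)| ≤ 1 * (K * dist x y) := by
    rw [abs_mul]
    exact mul_le_mul (abs_sin_le_one _) (h1.trans (by gcongr)) (abs_nonneg _) zero_le_one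
  have := abs_add_le ((sin x.2.1 - sin y.2.1) * F x.1) (sin y.2.1 * (F x.1 - F y.1))
  push_cast
  rw [Real.coe_toNNReal _ hB0]
  linarith

theorem clampV {m : ℝ → ℝ} {t0 : ℝ} (h : MH m t0) {L : ℝ} (hL : 0 ≤ L) :
    ∃ (W : ℝ × ℝ × ℝ → ℝ × ℝ × ℝ) (K : NNReal) (B : NNReal), LipschitzWith K W ∧
      (∀ x, ‖W x‖ ≤ B) ∧ (∀ x, |(W x).1| ≤ 1) ∧ ∀ x : ℝ × ℝ × ℝ, |x.1| ≤ L → W x = gV m x := by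
  have c1 : ContDiff ℝ 1 m := h.cd.of_le (by norm_num)
  obtain ⟨F, K1, B1, hF, hB1, eF⟩ := exists_clamp (h.cdd.div c1 fun x => (h.pos x).ne') hL
  obtain ⟨G, K2, B2, hG, hB2, eG⟩ := exists_clamp
    ((contDiff_const (c := (1:ℝ))).div c1 fun x => (h.pos x).ne') hL
  have B10 : 0 ≤ B1 := (abs_nonneg _).trans (hB1 0)
  have B20 : 0 ≤ B2 := (abs_nonneg _).trans (hB2 0)
  have l1 : LipschitzWith (1 * (1 * 1)) (fun x : ℝ × ℝ × ℝ => cos x.2.1) :=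
    Real.lipschitzWith_cos.comp (LipschitzWith.prod_fst.comp LipschitzWith.prod_snd)
  refine ⟨fun x => (cos x.2.1, -(sin x.2.1 * F x.1), sin x.2.1 * G x.1), _,
    Real.toNNReal (1 + B1 + B2), l1.prodMk ((lip_sin_mul hF hB1).neg.prodMk (lip_sin_mul hG hB2)),
    fun x => ?_, fun x => abs_cos_le_one _, fun x hx => ?_⟩
  · have a1 : |sin x.2.1 * F x.1| ≤ 1 * B1 := by
      rw [abs_mul]; exact mul_le_mul (abs_sin_le_one _) (hB1 _) (abs_nonneg _) zero_le_one
    have a2 : |sin x.2.1 * G x.1| ≤ 1 * B2 := by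
      rw [abs_mul]; exact mul_le_mul (abs_sin_le_one _) (hB2 _) (abs_nonneg _) zero_le_one
    have a0 := abs_cos_le_one x.2.1
    rw [Real.coe_toNNReal _ (by positivity)]
    refine norm_prod_le_iff.2 ⟨?_, norm_prod_le_iff.2 ⟨?_, ?_⟩⟩
    · simp only [Real.norm_eq_abs]; linarith
    · simp only [Real.norm_eq_abs, abs_neg]; linarith
    · simp only [Real.norm_eq_abs]; linarith
  · simp only [gV]
    rw [eF _ hx, eG _ hx]
    rfl

theorem fst_bound {x : ℝ → ℝ × ℝ × ℝ} {w : ℝ → ℝ × ℝ × ℝ} {a b : ℝ} (h0 : (0:ℝ) ∈ Ioo a b)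
    (hd : ∀ s ∈ Ioo a b, HasDerivAt x (w s) s) (hw : ∀ s, |(w s).1| ≤ 1) {s : ℝ}
    (hs : s ∈ Ioo a b) : |(x s).1| ≤ |(x 0).1| + |s| := by
  have := Convex.norm_image_sub_le_of_norm_hasDerivWithin_le (f := fun s => (x s).1)
    (f' := fun s => (w s).1) (C := 1) (s := Ioo a b)
    (fun s hs => (hd_fst (hd s hs)).hasDerivWithinAt) (fun s _ => hw s) (convex_Ioo a b) h0 hs
  simp only [Real.norm_eq_abs, one_mul, sub_zero] at this
  have := abs_sub_abs_le_abs_sub (x s).1 (x 0).1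
  linarith

/-- solution of the geodesic equation on `[-n, n]` -/
def IsSol (m : ℝ → ℝ) (x0 : ℝ × ℝ × ℝ) (n : ℝ) (x : ℝ → ℝ × ℝ × ℝ) : Prop :=
  x 0 = x0 ∧ ContinuousOn x (Icc (-n) n) ∧ ∀ s ∈ Ioo (-n) n, HasDerivAt x (gV m (x s)) s

theorem gV_fst (m : ℝ → ℝ) (x : ℝ × ℝ × ℝ) : |(gV m x).1| ≤ 1 := abs_cos_le_one _

theorem exists_sol {m : ℝ → ℝ} {t0 : ℝ} (h : MH m t0) (x0 : ℝ × ℝ × ℝ) {n : ℝ} (hn : 0 < n) :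
    ∃ x, IsSol m x0 n x := by
  obtain ⟨W, K, B, hK, hB, h1, hW⟩ := clampV h (L := |x0.1| + n) (by positivity)
  have pl : IsPicardLindelof (fun _ => W) (tmin := -n) (tmax := n) ⟨0, by constructor <;> linarith⟩ x0
      (B * Real.toNNReal n) 0 B K :=
    { lipschitzOnWith := fun _ _ => hK.lipschitzOnWith
      continuousOn := fun _ _ => continuousOn_const
      norm_le := fun _ _ x _ => hB x
      mul_max_le := by simp [hn.le] }
  obtain ⟨x, hx0, hx⟩ := pl.exists_eq_forall_mem_Icc_hasDerivWithinAt₀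
  have hd : ∀ s ∈ Ioo (-n) n, HasDerivAt x (W (x s)) s := fun s hs =>
    (hx s ⟨hs.1.le, hs.2.le⟩).hasDerivAt (Icc_mem_nhds hs.1 hs.2)
  refine ⟨x, hx0, fun s hs => (hx s hs).continuousWithinAt, fun s hs => ?_⟩
  have := fst_bound ⟨by linarith, hn⟩ hd (fun s => h1 _) hs
  have e : x 0 = x0 := hx0
  rw [e] at this
  have h2 : |s| ≤ n := abs_le.2 ⟨hs.1.le, hs.2.le⟩
  rw [← hW _ (by linarith)]
  exact hd s hs

theorem sol_unique {m : ℝ → ℝ} {t0 : ℝ} (h : MH m t0) {x0 : ℝ × ℝ × ℝ} {n k : ℝ} (hn : 0 < n)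
    (hnk : n ≤ k) {x y : ℝ → ℝ × ℝ × ℝ} (hx : IsSol m x0 n x) (hy : IsSol m x0 k y) :
    EqOn x y (Icc (-n) n) := by
  obtain ⟨W, K, B, hK, hB, h1, hW⟩ := clampV h (L := |x0.1| + n) (by positivity)
  have conv : ∀ z, (∀ s ∈ Ioo (-n) n, HasDerivAt z (gV m (z s)) s) → z 0 = x0 →
      ∀ s ∈ Ioo (-n) n, HasDerivAt z (W (z s)) s := by
    intro z hz hz0 s hs
    have := fst_bound ⟨by linarith, hn⟩ hz (fun s => gV_fst _ _) hs
    rw [hz0] at this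
    have h2 : |s| ≤ n := abs_le.2 ⟨hs.1.le, hs.2.le⟩
    rw [hW _ (by linarith)]
    exact hz s hs
  have sub : Ioo (-n) n ⊆ Ioo (-k) k := Ioo_subset_Ioo (by linarith) hnk
  exact ODE_solution_unique_of_mem_Icc (v := fun _ => W) (s := fun _ => univ) (t₀ := 0)
    (fun _ _ => hK.lipschitzOnWith) ⟨by linarith, hn⟩ hx.2.1 (conv x hx.2.2 hx.1)
    (fun _ _ => mem_univ _) (hy.2.1.mono (Icc_subset_Icc (by linarith) hnk))
    (conv y (fun s hs => hy.2.2 s (sub hs)) hy.1) (fun _ _ => mem_univ _) (hx.1.trans hy.1.symm)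

theorem exists_global {m : ℝ → ℝ} {t0 : ℝ} (h : MH m t0) (x0 : ℝ × ℝ × ℝ) :
    ∃ x : ℝ → ℝ × ℝ × ℝ, x 0 = x0 ∧ ∀ s, HasDerivAt x (gV m (x s)) s := by
  choose X hX using fun n : ℕ => exists_sol h x0 (n := (n:ℝ) + 1) (by positivity)
  refine ⟨fun s => X ⌈|s|⌉₊ s, ?_, fun s => ?_⟩
  · simpa using (hX 0).1
  · set N := ⌈|s|⌉₊ + 1 with hN
    have hsN : |s| < (N:ℝ) := by
      have := Nat.le_ceil |s|
      rw [hN]; push_cast; linarith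
    have eq : ∀ r, |r| < (N:ℝ) → X ⌈|r|⌉₊ r = X N r := by
      intro r hr
      have hle : ⌈|r|⌉₊ ≤ N := Nat.ceil_le.2 hr.le
      have hle' : (⌈|r|⌉₊ : ℝ) ≤ N := by exact_mod_cast hle
      have hce := Nat.le_ceil |r|
      refine sol_unique h (by positivity) (by linarith) (hX ⌈|r|⌉₊) (hX N) (abs_le.1 ?_)
      linarith
    have ev : (fun s => X ⌈|s|⌉₊ s) =ᶠ[nhds s] X N := by
      filter_upwards [continuous_abs.continuousAt.eventually_lt continuousAt_const hsN] with r hr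
      exact eq r hr
    have := (hX N).2.2 s (abs_lt.1 (by linarith))
    beta_reduce
    rw [eq s hsN]
    exact this.congr_of_eventuallyEq ev

theorem flow_cont {m : ℝ → ℝ} {t0 : ℝ} (h : MH m t0) {u : ℝ} {X : ℝ → ℝ → ℝ × ℝ × ℝ}
    (h0 : ∀ β, X β 0 = (u, β, 0)) (hd : ∀ β s, HasDerivAt (X β) (gV m (X β s)) s) {S : ℝ}
    (hS : 0 < S) : Continuous fun β => X β S := by
  obtain ⟨W, K, B, hK, hB, h1, hW⟩ := clampV h (L := |u| + (S + 1)) (by positivity)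
  have conv : ∀ β, ∀ s ∈ Icc 0 S, HasDerivAt (X β) (W (X β s)) s := by
    intro β s hs
    have := fst_bound (a := -(S+1)) (b := S + 1) ⟨by linarith, by linarith⟩ (fun s _ => hd β s)
      (fun s => gV_fst _ _) (s := s) ⟨by linarith [hs.1], by linarith [hs.2]⟩
    rw [h0] at this
    simp only at this
    have h2 : |s| ≤ S := by rw [abs_of_nonneg hs.1]; exact hs.2
    rw [hW _ (by linarith)]
    exact hd β s
  have c : ∀ β, Continuous (X β) := fun β =>
    continuous_iff_continuousAt.2 fun s => (hd β s).continuousAt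
  have : LipschitzWith (Real.toNNReal (exp (K * S))) fun β => X β S := by
    apply LipschitzWith.of_dist_le_mul
    intro β β'
    have := dist_le_of_trajectories_ODE (v := fun _ => W) (K := K) (a := 0) (b := S)
      (f := X β) (g := X β') (δ := dist β β') (fun _ => hK) (c β).continuousOn
      (fun s hs => (conv β s ⟨hs.1, hs.2.le⟩).hasDerivWithinAt) (c β').continuousOn
      (fun s hs => (conv β' s ⟨hs.1, hs.2.le⟩).hasDerivWithinAt)
      (by rw [h0, h0]; simp [Prod.dist_eq]) S ⟨hS.le, le_rfl⟩
    rw [Real.coe_toNNReal _ (exp_pos _).le]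
    rw [sub_zero] at this
    linarith
  exact this.continuous

theorem geo_of_sol {m : ℝ → ℝ} {t0 : ℝ} (h : MH m t0) {x : ℝ → ℝ × ℝ × ℝ}
    (hd : ∀ s, HasDerivAt x (gV m (x s)) s) :
    Geo m (m (x 0).1 * sin (x 0).2.1) (fun s => (x s).1) (fun s => cos (x s).2.1)
      (fun s => (x s).2.2) := by
  have d1 : ∀ s, HasDerivAt (fun s => (x s).1) (cos (x s).2.1) s := fun s => hd_fst (hd s)
  have d2 : ∀ s, HasDerivAt (fun s => (x s).2.1) (-(sin (x s).2.1 * (deriv m (x s).1 / m (x s).1))) s :=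
    fun s => hd_fst (hd_snd (hd s))
  have d3 : ∀ s, HasDerivAt (fun s => (x s).2.2) (sin (x s).2.1 * (1 / m (x s).1)) s :=
    fun s => hd_snd (hd_snd (hd s))
  have dν : ∀ s, HasDerivAt (fun s => m (x s).1 * sin (x s).2.1) 0 s := by
    intro s
    have := h.pos (x s).1
    refine (((h.hd (x s).1).comp s (d1 s)).mul (d2 s).sin).congr_deriv ?_
    simp only [Function.comp]
    field_simp
    ring
  have hν : ∀ s, m (x s).1 * sin (x s).2.1 = m (x 0).1 * sin (x 0).2.1 := fun s =>
    is_const_of_deriv_eq_zero (fun s => (dν s).differentiableAt) (fun s => (dν s).deriv) s 0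
  refine ⟨d1, fun s => ?_, fun s => ?_, fun s => ?_⟩
  · have := h.pos (x s).1
    refine (d2 s).cos.congr_deriv ?_
    rw [← hν s]
    field_simp
  · have := h.pos (x s).1
    refine (d3 s).congr_deriv ?_
    rw [← hν s]
    field_simp
  · have := h.pos (x s).1
    rw [← hν s, mul_pow, mul_div_cancel_left₀ _ (by positivity)]
    exact cos_sq_add_sin_sq _

/-- The family of all unit speed geodesics from `(u, 0)`. -/
theorem geo_family {m : ℝ → ℝ} {t0 : ℝ} (h : MH m t0) (u : ℝ) :
    ∃ T P Θ : ℝ → ℝ → ℝ, (∀ β, Geo m (m u * sin β) (T β) (P β) (Θ β)) ∧ (∀ β, T β 0 = u) ∧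
      (∀ β, P β 0 = cos β) ∧ (∀ β, Θ β 0 = 0) ∧ (∀ s > 0, Continuous fun β => T β s) ∧
      (∀ s > 0, Continuous fun β => Θ β s) := by
  choose X h0 hd using fun β : ℝ => exists_global h (u, β, 0)
  refine ⟨fun β s => (X β s).1, fun β s => cos (X β s).2.1, fun β s => (X β s).2.2, fun β => ?_,
    fun β => ?_, fun β => ?_, fun β => ?_, fun s hs => ?_, fun s hs => ?_⟩
  · have := geo_of_sol h (hd β)
    rw [h0] at this
    exact this
  · simp [h0]
  · simp [h0]
  · simp [h0]
  · exact continuous_fst.comp (flow_cont h h0 hd hs)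
  · exact continuous_snd.comp (continuous_snd.comp (flow_cont h h0 hd hs))

end

section
open Real Set

/-- The shooting sets are open. -/
theorem shoot_open {G Θ : ℝ → ℝ → ℝ}
    (hGc : ∀ s > 0, Continuous fun β => G β s) (hΘc : ∀ s > 0, Continuous fun β => Θ β s)
    (hL : ∀ β x y, |G β y - G β x| ≤ |y - x|) (hΘ : ∀ β, Continuous (Θ β))
    (hmono : ∀ β, ∀ s > 0, Θ β s = π → StrictMono (Θ β)) :
    IsOpen {β | ∃ s > 0, Θ β s = π ∧ 0 < G β s} := by
  rw [isOpen_iff_mem_nhds]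
  rintro β ⟨s, hs, h1, h2⟩
  have hm := hmono β s hs h1
  set δ := min (s / 2) (G β s / 4) with hδ
  have hδ0 : 0 < δ := by rw [hδ]; exact lt_min (by linarith) (by linarith)
  have hδ1 : δ ≤ s / 2 := min_le_left _ _
  have hδ2 : δ ≤ G β s / 4 := min_le_right _ _
  have a1 : Θ β (s - δ) < π := by rw [← h1]; exact hm (by linarith)
  have a2 : π < Θ β (s + δ) := by rw [← h1]; exact hm (by linarith)
  have e1 := (hΘc (s - δ) (by linarith)).continuousAt.eventually_lt
    (continuousAt_const (x := β)) a1
  have e2 := (continuousAt_const (x := β)).eventually_lt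
    (hΘc (s + δ) (by linarith)).continuousAt a2
  have e3 := (continuousAt_const (x := β)).eventually_lt
    (hGc s hs).continuousAt (show G β s / 2 < G β s by linarith)
  filter_upwards [e1, e2, e3] with b b1 b2 b3
  obtain ⟨z, hz, ez⟩ := intermediate_value_Icc (show s - δ ≤ s + δ by linarith)
    (hΘ b).continuousOn (show π ∈ Icc _ _ from ⟨b1.le, b2.le⟩)
  refine ⟨z, by linarith [hz.1], ez, ?_⟩
  have l := hL b s z
  have : |z - s| ≤ δ := abs_le.2 ⟨by linarith [hz.1], by linarith [hz.2]⟩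
  have := (abs_le.1 (l.trans this)).1
  linarith

theorem shoot_half {G Θ : ℝ → ℝ → ℝ}
    (hGc : ∀ s > 0, Continuous fun β => G β s) (hΘc : ∀ s > 0, Continuous fun β => Θ β s)
    (hL : ∀ β x y, |G β y - G β x| ≤ |y - x|) (hΘ : ∀ β, Continuous (Θ β))
    (hmono : ∀ β, ∀ s > 0, Θ β s = π → StrictMono (Θ β)) (hΘ0 : ∀ β, Θ β 0 = 0)
    {A B βs βe S : ℝ} (hs : βs ∈ Icc A B) (he : βe ∈ Icc A B)
    (hsP : ∃ s > 0, Θ βs s = π ∧ 0 < G βs s) (heP : ∀ s, Θ βe s ≠ π)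
    (hS : ∀ β ∈ Icc A B, ∀ s > 0, Θ β s = π → 0 < G β s → s ≤ S)
    (hno : ∀ β ∈ Icc A B, ∀ s > 0, Θ β s = π → G β s ≠ 0) : False := by
  set P := {β | ∃ s > 0, Θ β s = π ∧ 0 < G β s} with hP
  have oP : IsOpen P := shoot_open hGc hΘc hL hΘ hmono
  have oN : IsOpen {β | ∃ s > 0, Θ β s = π ∧ 0 < - G β s} :=
    shoot_open (G := fun β s => - G β s) (fun s hs => (hGc s hs).neg) hΘc
      (fun β x y => by rw [show - G β y - - G β x = -(G β y - G β x) by ring, abs_neg]; exact hL β x y)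
      hΘ hmono
  have hS0 : 0 < S := by
    obtain ⟨s, h1, h2, h3⟩ := hsP
    exact h1.trans_le (hS βs hs s h1 h2 h3)
  have hsub : ∀ β ∈ P ∩ Icc A B, π ≤ Θ β S := by
    rintro β ⟨⟨s, h1, h2, h3⟩, h4⟩
    rw [← h2]
    exact (hmono β s h1 h2).monotone (hS β h4 s h1 h2 h3)
  have hcl : ∀ β ∈ Icc A B, β ∈ closure (P ∩ Icc A B) → β ∈ P := by
    intro β hβ hc
    have h1 : π ≤ Θ β S := by
      have : IsClosed {β | π ≤ Θ β S} := isClosed_le continuous_const (hΘc S hS0)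
      exact closure_minimal hsub this hc
    obtain ⟨z, hz, ez⟩ := intermediate_value_Icc hS0.le
      (hΘ β).continuousOn (show π ∈ Icc _ _ from ⟨by rw [hΘ0]; exact pi_pos.le, h1⟩)
    have hz0 : 0 < z := by
      rcases hz.1.eq_or_lt with h | h
      · rw [← h, hΘ0] at ez
        exact absurd ez.symm pi_pos.ne'
      · exact h
    rcases lt_trichotomy (G β z) 0 with h | h | h
    · exfalso
      obtain ⟨b, ⟨s1, h1, h2, h3⟩, ⟨s2, k1, k2, k3⟩, -⟩ :=
        _root_.mem_closure_iff.1 hc _ oN ⟨z, hz0, ez, by linarith⟩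
      have := (hmono b s1 h1 h2).injective (h2.trans k2.symm)
      subst this
      linarith
    · exact absurd h (hno β hβ z hz0 ez)
    · exact ⟨z, hz0, ez, h⟩
  have pre : IsPreconnected (Icc A B) := isPreconnected_Icc
  obtain ⟨b, b1, b2, b3⟩ := pre P (closure (P ∩ Icc A B))ᶜ oP isClosed_closure.isOpen_compl
    (fun β hβ => by
      by_cases h : β ∈ closure (P ∩ Icc A B)
      · exact Or.inl (hcl β hβ h)
      · exact Or.inr h)
    ⟨βs, hs, hsP⟩
    ⟨βe, he, fun h => by
      obtain ⟨s, -, h2, -⟩ := hcl βe he h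
      exact heP s h2⟩
  exact b3 (subset_closure ⟨b2, b1⟩)

/-- Crude upper bound for the distance. -/
theorem wDist_crude {m : ℝ → ℝ} (hmc : Continuous m) (hm : ∀ t, 0 < m t) (x y k : ℝ) :
    wDist m (x, 0) (y, k) ≤ |y - x| + |k| * m x := by
  have h1 : wDist m (x, 0) (x, k) ≤ |k| * m x := by
    refine (wDist_le (c := fun s => (x, s * k)) zero_le_one (by fun_prop) (by simp)
      (by simp)).trans_eq ?_
    unfold wLength
    have : ∀ s : ℝ, deriv (fun s : ℝ => s * k) s = k := fun s => by
      simp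
    simp only [deriv_const, this]
    rw [intervalIntegral.integral_const, ← mul_pow]
    simp only [ne_eq, OfNat.ofNat_ne_zero, not_false_eq_true, zero_pow, zero_add,
      Real.sqrt_sq_eq_abs, abs_mul, abs_of_pos (hm x)]
    simp [mul_comm]
  have h2 : wDist m (x, k) (y, k) ≤ |y - x| := by
    refine (wDist_le (c := fun s => (x + s * (y - x), k)) zero_le_one (by fun_prop) (by simp)
      (by simp)).trans_eq ?_
    unfold wLength
    have : ∀ s : ℝ, deriv (fun s : ℝ => x + s * (y - x)) s = y - x := fun s => by
      simp
    simp only [deriv_const, this]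
    simp [Real.sqrt_sq_eq_abs]
  linarith [wDist_triangle hmc (x, 0) (x, k) (y, k)]

namespace Geo
variable {m t p θ : ℝ → ℝ} {ν t0 : ℝ}

/-- Geodesics with `ν ≥ m t₀` do not cross the parallel `-t₀`. -/
theorem lower (h : MH m t0) (g : Geo m ν t p θ) (h1 : m t0 ≤ ν) (h2 : -t0 ≤ t 0) (s : ℝ) :
    -t0 ≤ t s := by
  by_contra hc
  push Not at hc
  obtain ⟨z, -, ez⟩ := intermediate_value_uIcc (a := 0) (b := s) (f := t) g.tcont.continuousOn
    (show -t0 ∈ uIcc _ _ by rw [mem_uIcc]; exact Or.inr ⟨hc.le, h2⟩)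
  have hm0 : m (t z) = m t0 := by rw [ez, h.even]
  have hν : m (t z) = ν := le_antisymm (hm0.trans_le h1) (g.ν_le h.pos z)
  have hν0 : 0 ≤ ν := by rw [← hν]; exact (h.pos _).le
  have hp := (g.p_zero_iff h.pos hν0 z).2 hν
  have hp0 := g.const_of_crit h hp (by rw [ez, deriv_even h.even, h.dzero, neg_zero])
  have : t s = t z := by
    have := is_const_of_deriv_eq_zero (f := t) (fun s => (g.ht s).differentiableAt)
      (fun s => by rw [(g.ht s).deriv, hp0 s]) s z
    exact this
  linarith

end Geo

theorem shoot {m : ℝ → ℝ} {t0 : ℝ} (h : MH m t0) {u : ℝ} (hu : 0 < u)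
    (hcase : u < t0 → π ≤ phi m (m u)) (t1 : ℝ) :
    ∃ (ν : ℝ) (t p θ : ℝ → ℝ), 0 < ν ∧ Geo m ν t p θ ∧ t 0 = u ∧ θ 0 = 0 ∧
      ∃ a > 0, θ a = π ∧ t a = t1 := by
  obtain ⟨T, P, Θ, hg, hT0, hP0, hΘ0, hTc, hΘc⟩ := geo_family h u
  by_contra hcon
  have hmu := h.pos u
  have hm0 := h.pos t0
  have ht0 := h.t0pos
  have hsin : ∀ β, ∀ s > 0, Θ β s = π → 0 < m u * sin β := by
    intro β s hs e
    by_contra hle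
    push Not at hle
    have : Antitone (Θ β) := by
      apply antitone_of_deriv_nonpos (fun s => ((hg β).hθ s).differentiableAt)
      intro x
      rw [((hg β).hθ x).deriv]
      exact div_nonpos_of_nonpos_of_nonneg hle (by positivity)
    have := this hs.le
    rw [e, hΘ0] at this
    linarith [pi_pos]
  have hno : ∀ β, ∀ s > 0, Θ β s = π → T β s ≠ t1 := by
    intro β s hs e1 e2
    exact hcon ⟨_, T β, P β, Θ β, hsin β s hs e1, hg β, hT0 β, hΘ0 β, s, hs, e1, e2⟩
  have hmono : ∀ β, ∀ s > 0, Θ β s = π → StrictMono (Θ β) := fun β s hs e =>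
    (hg β).θmono h.pos (hsin β s hs e)
  have hΘ : ∀ β, Continuous (Θ β) := fun β => (hg β).θcont
  have hlen : ∀ β, ∀ s > 0, Θ β s = π → s ≤ |T β s - u| + π * m u := by
    intro β s hs e
    have c := (hg β).core h (by rw [hT0]; exact hu) (by rw [hT0]; exact hcase) (a := s)
      (by rw [e, hΘ0, sub_zero, abs_of_pos pi_pos]) hs.le
    rw [hT0, hΘ0, e] at c
    have := wDist_crude h.cont h.pos u (T β s) π
    rw [c, abs_of_pos pi_pos] at this
    exact this
  set x := m t0 / m u with hx
  have hx0 : 0 < x := by positivity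
  have hx1 : x ≤ 1 := (div_le_one hmu).2 (h.min_le u)
  have hxm : m u * x = m t0 := by rw [hx]; field_simp
  set βs := π - arcsin x with hβs
  have ha0 : 0 < arcsin x := arcsin_pos.2 hx0
  have ha1 : arcsin x ≤ π / 2 := arcsin_le_pi_div_two x
  have hsx : sin (arcsin x) = x := sin_arcsin (by linarith) hx1
  have hsβ : sin βs = x := by rw [hβs, sin_pi_sub, hsx]
  -- upper region
  have hup : ∀ β ∈ Icc βs π, ∀ s > 0, T β s ≤ u := by
    intro β hβ s hs
    have s0 : 0 ≤ sin β := sin_nonneg_of_nonneg_of_le_pi (by linarith [hβ.1, pi_pos]) hβ.2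
    have s1 : sin β ≤ x := by
      rw [← hsx, ← sin_pi_sub β]
      exact sin_le_sin_of_le_of_le_pi_div_two (by linarith [hβ.2, pi_pos]) ha1
        (by linarith [hβ.1])
    have c0 : cos β ≤ 0 := cos_nonpos_of_pi_div_two_le_of_le (by linarith [hβ.1])
      (by linarith [hβ.2, pi_pos])
    have hp : ∀ s, P β s ≤ 0 := by
      rcases (hg β).sign_const h (by positivity) (by rw [← hxm]; gcongr) with k | k | k
      · exact fun s => (k s).le
      · have := k 0
        rw [hP0] at this
        linarith
      · exact fun s => (k s).le
    have : Antitone (T β) := by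
      apply antitone_of_deriv_nonpos (fun s => ((hg β).ht s).differentiableAt)
      intro x
      rw [((hg β).ht x).deriv]
      exact hp x
    have := this hs.le
    rwa [hT0] at this
  have hlow : ∀ β ∈ Icc 0 βs, ∀ s > 0, -t0 ≤ T β s := by
    intro β hβ s hs
    by_cases hν : m t0 ≤ m u * sin β
    · exact (hg β).lower h hν (by rw [hT0]; linarith) s
    push Not at hν
    have s0 : 0 ≤ sin β := sin_nonneg_of_nonneg_of_le_pi hβ.1 (by linarith [hβ.2])
    have hβ2 : β < π / 2 := by
      by_contra hc
      push Not at hc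
      have : x ≤ sin β := by
        rw [← hsx, ← sin_pi_sub β]
        exact sin_le_sin_of_le_of_le_pi_div_two (by linarith) (by linarith)
          (by linarith [hβ.2])
      have := mul_le_mul_of_nonneg_left this hmu.le
      linarith
    have c0 : 0 < cos β := cos_pos_of_mem_Ioo ⟨by linarith [hβ.1, pi_pos], hβ2⟩
    have hp : ∀ s, 0 ≤ P β s := by
      rcases (hg β).sign_const h (by positivity) hν.le with k | k | k
      · exact fun s => (k s).ge
      · exact fun s => (k s).le
      · have := k 0
        rw [hP0] at this
        linarith
    have : Monotone (T β) := by
      apply monotone_of_deriv_nonneg (fun s => ((hg β).ht s).differentiableAt)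
      intro x
      rw [((hg β).ht x).deriv]
      exact hp x
    have := this hs.le
    rw [hT0] at this
    linarith
  have hβ0 : 0 ≤ βs := by linarith [pi_pos]
  have hβπ : βs ≤ π := by linarith
  -- `βs` reaches the opposite meridian
  have hreach : ∃ s > 0, Θ βs s = π := by
    obtain ⟨M, hM⟩ := isCompact_Icc.exists_bound_of_continuousOn (s := Icc (-t0) u)
      h.cont.continuousOn
    have hM0 : 0 < M := by
      have := hM u ⟨by linarith, le_rfl⟩
      rw [Real.norm_eq_abs, abs_of_pos hmu] at this
      linarith
    set c := m t0 / M ^ 2 with hc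
    have hc0 : 0 < c := by positivity
    have hν : m u * sin βs = m t0 := by rw [hsβ, hxm]
    set s1 := π / c with hs1
    have hs10 : 0 < s1 := by positivity
    have hge : π ≤ Θ βs s1 := by
      have := Convex.mul_sub_le_image_sub_of_le_deriv (convex_Icc 0 s1) (f := Θ βs) (C := c)
        (hΘ βs).continuousOn (fun s => fun _ => ((hg βs).hθ s).differentiableAt.differentiableWithinAt)
        (by
          intro s hs
          rw [interior_Icc] at hs
          rw [((hg βs).hθ s).deriv, hν, hc]
          have h1 := hM (T βs s) ⟨hlow βs ⟨hβ0, le_rfl⟩ s hs.1, hup βs ⟨le_rfl, hβπ⟩ s hs.1⟩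
          have h2 := h.pos (T βs s)
          rw [Real.norm_eq_abs, abs_of_pos h2] at h1
          gcongr)
        0 ⟨le_rfl, hs10.le⟩ s1 ⟨hs10.le, le_rfl⟩ hs10.le
      rw [hΘ0, sub_zero, sub_zero, hs1, mul_div_cancel₀ _ hc0.ne'] at this
      rw [hs1]
      exact this
    obtain ⟨z, hz, ez⟩ := intermediate_value_Icc hs10.le
      (hΘ βs).continuousOn (show π ∈ Icc _ _ from ⟨by rw [hΘ0]; exact pi_pos.le, hge⟩)
    refine ⟨z, ?_, ez⟩
    rcases hz.1.eq_or_lt with h | h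
    · rw [← h, hΘ0] at ez
      exact absurd ez.symm pi_pos.ne'
    · exact h
  have hend : ∀ β, sin β = 0 → ∀ s, Θ β s ≠ π := by
    intro β hβ s e
    have := is_const_of_deriv_eq_zero (f := Θ β) (fun s => ((hg β).hθ s).differentiableAt)
      (fun s => by rw [((hg β).hθ s).deriv, hβ]; simp) s 0
    rw [e, hΘ0] at this
    exact pi_pos.ne' this
  obtain ⟨sh, hsh, esh⟩ := hreach
  rcases lt_or_gt_of_ne (hno βs sh hsh esh) with hlt | hgt
  · refine shoot_half (G := fun β s => t1 - T β s) (Θ := Θ) (A := 0) (B := βs) (βs := βs) (βe := 0)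
      (S := (u + t0 + |t1|) + π * m u)
      (fun s hs => continuous_const.sub (hTc s hs)) hΘc
      (fun β x y => by
        have := (hg β).t_lip y x
        rw [abs_sub_comm y x]
        convert this using 2
        ring) hΘ hmono hΘ0 ⟨hβ0, le_rfl⟩ ⟨le_rfl, hβ0⟩ ⟨sh, hsh, esh, by linarith⟩
      (hend 0 sin_zero) ?_ ?_
    · intro β hβ s hs e hG
      refine (hlen β s hs e).trans ?_
      have h1 := hlow β hβ s hs
      have h2 := le_abs_self t1
      have h3 : |T β s - u| ≤ u + t0 + |t1| :=
        abs_le.2 ⟨by linarith [abs_nonneg t1], by linarith⟩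
      linarith
    · intro β hβ s hs e e2
      exact hno β s hs e (by linarith)
  · refine shoot_half (G := fun β s => T β s - t1) (Θ := Θ) (A := βs) (B := π) (βs := βs) (βe := π)
      (S := (u + t0 + |t1|) + π * m u)
      (fun s hs => (hTc s hs).sub continuous_const) hΘc
      (fun β x y => by
        have := (hg β).t_lip x y
        convert this using 2
        ring) hΘ hmono hΘ0 ⟨le_rfl, hβπ⟩ ⟨hβπ, le_rfl⟩ ⟨sh, hsh, esh, by linarith⟩
      (hend π sin_pi) ?_ ?_
    · intro β hβ s hs e hG
      refine (hlen β s hs e).trans ?_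
      have h1 := hup β hβ s hs
      have h2 := neg_abs_le t1
      have h3 : |T β s - u| ≤ u + t0 + |t1| :=
        abs_le.2 ⟨by linarith, by linarith [abs_nonneg t1]⟩
      linarith
    · intro β hβ s hs e e2
      exact hno β s hs e (by linarith)

end

section
open Real Set

namespace Geo
variable {m t p θ : ℝ → ℝ} {ν t0 : ℝ}

theorem core_abs (h : MH m t0) (g : Geo m ν t p θ) (h2 : t 0 ≠ 0)
    (hcase : |t 0| < t0 → π ≤ phi m (m (t 0))) {a : ℝ} (hθ : |θ a - θ 0| ≤ π) (ha : 0 ≤ a) :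
    wDist m (t 0, θ 0) (t a, θ a) = a := by
  rcases lt_or_gt_of_ne h2 with hn | hp
  · rw [abs_of_neg hn] at hcase
    have c := (g.negt h.even).core h (show 0 < - t 0 by linarith)
      (by simpa only [h.even] using hcase) hθ ha
    have k := wDist_map h.cont (-1) 1 0 (by norm_num) (by norm_num)
      (fun t => by rw [neg_one_mul, h.even]) (t 0, θ 0) (t a, θ a)
    simp only [neg_one_mul, one_mul, add_zero] at k
    rw [c] at k
    exact le_antisymm (g.dist_le0 h.cont h.pos ha) k
  · rw [abs_of_pos hp] at hcase
    exact g.core h hp hcase hθ ha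

theorem of_isUnit (hm : ∀ t, 0 < m t) {γ : ℝ → ℝ × ℝ} (hγ : IsUnitGeodesic m γ) :
    ∃ ν, Geo m ν (fun s => (γ s).1) (deriv fun s => (γ s).1) (fun s => (γ s).2) := by
  obtain ⟨h1, h2, ⟨ν, h3⟩, h4⟩ := hγ
  have hc1 : ContDiff ℝ 2 (fun s => (γ s).1) := h1.fst
  have hc2 : ContDiff ℝ 2 (fun s => (γ s).2) := h1.snd
  have hd : ContDiff ℝ 1 (deriv fun s => (γ s).1) := by
    rw [show (2 : WithTop ℕ∞) = 1 + 1 by norm_num, contDiff_succ_iff_deriv] at hc1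
    exact hc1.2.2
  have e : ∀ s, deriv (fun s => (γ s).2) s = ν / m (γ s).1 ^ 2 := by
    intro s
    have := hm (γ s).1
    rw [eq_div_iff (by positivity), ← h3 s]
    ring
  refine ⟨ν, ⟨fun s => ?_, fun s => ?_, fun s => ?_, fun s => ?_⟩⟩
  · exact (hc1.differentiable (by norm_num) s).hasDerivAt
  · refine (hd.differentiable (by norm_num) s).hasDerivAt.congr_deriv ?_
    have := hm (γ s).1
    rw [h2 s, e s]
    field_simp
  · exact (hc2.differentiable (by norm_num) s).hasDerivAt.congr_deriv (e s)
  · have := hm (γ s).1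
    rw [← h4 s, e s]
    field_simp

theorem isUnit (h : MH m t0) (g : Geo m ν t p θ) : IsUnitGeodesic m (fun s => (t s, θ s)) := by
  have dt : deriv t = p := funext fun s => (g.ht s).deriv
  have dp : deriv p = fun s => ν ^ 2 * (deriv m (t s) / m (t s) ^ 3) := funext fun s => (g.hp s).deriv
  have dθ : deriv θ = fun s => ν / m (t s) ^ 2 := funext fun s => (g.hθ s).deriv
  have hp1 : ContDiff ℝ 1 p := by
    rw [contDiff_one_iff_deriv]
    refine ⟨fun s => (g.hp s).differentiableAt, ?_⟩
    rw [dp]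
    have := h.contd
    have := h.cont
    have := g.tcont
    have : ∀ s, m (t s) ^ 3 ≠ 0 := fun s => (pow_pos (h.pos _) 3).ne'
    fun_prop (disch := assumption)
  have ht2 : ContDiff ℝ 2 t := by
    rw [show (2 : WithTop ℕ∞) = 1 + 1 by norm_num, contDiff_succ_iff_deriv]
    refine ⟨fun s => (g.ht s).differentiableAt, by simp, ?_⟩
    rw [dt]
    exact hp1
  have hθ2 : ContDiff ℝ 2 θ := by
    rw [show (2 : WithTop ℕ∞) = 1 + 1 by norm_num, contDiff_succ_iff_deriv]
    refine ⟨fun s => (g.hθ s).differentiableAt, by simp, ?_⟩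
    rw [dθ]
    exact contDiff_const.div (((h.cd.comp ht2).of_le (by norm_num)).pow 2)
      fun s => (pow_pos (h.pos _) 2).ne'
  refine ⟨ht2.prodMk hθ2, fun s => ?_, ⟨ν, fun s => ?_⟩, fun s => ?_⟩
  · have := h.pos (t s)
    simp only
    rw [show deriv (fun u => t u) = p from dt, show deriv (fun u => θ u) = _ from dθ, dp]
    field_simp
  · have := h.pos (t s)
    simp only
    rw [show deriv (fun u => θ u) = _ from dθ]
    field_simp
  · have := h.pos (t s)
    simp only
    rw [show deriv (fun u => t u) = p from dt, show deriv (fun u => θ u) = _ from dθ, ← g.he s]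
    field_simp

end Geo

theorem shoot_abs {m : ℝ → ℝ} {t0 : ℝ} (h : MH m t0) {u : ℝ} (hu : u ≠ 0)
    (hcase : |u| < t0 → π ≤ phi m (m u)) (t1 : ℝ) :
    ∃ (ν : ℝ) (t p θ : ℝ → ℝ), 0 < ν ∧ Geo m ν t p θ ∧ t 0 = u ∧ θ 0 = 0 ∧
      ∃ a > 0, θ a = π ∧ t a = t1 := by
  rcases lt_or_gt_of_ne hu with hn | hp
  · rw [abs_of_neg hn] at hcase
    obtain ⟨ν, t, p, θ, h1, g, h2, h3, a, h4, h5, h6⟩ := shoot h (show 0 < -u by linarith)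
      (by simpa only [h.even] using hcase) (-t1)
    exact ⟨ν, _, _, θ, h1, g.negt h.even, by simp [h2], h3, a, h4, h5, by simp [h6]⟩
  · rw [abs_of_pos hp] at hcase
    exact shoot h hp hcase t1

theorem cylDist_le (m : ℝ → ℝ) (p q : ℝ × ℝ) : cylDist m (proj p) (proj q) ≤ wDist m p q := by
  apply csInf_le
  · refine ⟨0, ?_⟩
    rintro L ⟨p, q, -, -, rfl⟩
    exact wDist_nonneg m p q
  · exact ⟨p, q, rfl, rfl, rfl⟩

theorem cylDist_eq {m : ℝ → ℝ} (hm : Continuous m) {p q : ℝ × ℝ} (hpq : |q.2 - p.2| ≤ π) :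
    cylDist m (proj p) (proj q) = wDist m p q := by
  apply le_antisymm (cylDist_le m p q)
  refine le_csInf ⟨wDist m p q, p, q, rfl, rfl, rfl⟩ ?_
  rintro L ⟨p', q', hp, hq, rfl⟩
  simp only [proj, Prod.mk.injEq] at hp hq
  obtain ⟨hp1, hp2⟩ := hp
  obtain ⟨hq1, hq2⟩ := hq
  rw [Real.Angle.angle_eq_iff_two_pi_dvd_sub] at hp2 hq2
  obtain ⟨j, hj⟩ := hp2
  obtain ⟨k, hk⟩ := hq2
  set D := q.2 - p.2 with hD
  set D' := q'.2 - p'.2 with hD'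
  have hDD : D' = D + 2 * π * ((k - j : ℤ) : ℝ) := by push_cast; linarith
  have habs : |D| ≤ |D'| := by
    by_cases hn : k - j = 0
    · rw [hDD, hn]; simp
    · have h1 : (1 : ℝ) ≤ |((k - j : ℤ) : ℝ)| := by exact_mod_cast Int.one_le_abs hn
      have h2 : |2 * π * ((k - j : ℤ) : ℝ)| = 2 * π * |((k - j : ℤ) : ℝ)| := by
        rw [abs_mul, abs_of_pos (by positivity)]
      have h3 : 2 * π * ((k - j : ℤ) : ℝ) = D' - D := by linarith
      have h4 := abs_sub D' D
      rw [h3] at h2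
      nlinarith [pi_pos]
  have hl : D / D' * D' = D := by
    by_cases h0 : D' = 0
    · rw [h0, abs_zero] at habs
      have := abs_nonpos_iff.1 habs
      rw [this, h0]; simp
    · field_simp
  have hl2 : (D / D') ^ 2 ≤ 1 := by
    rw [div_pow]
    exact div_le_one_of_le₀ (sq_le_sq.2 habs) (sq_nonneg _)
  have := wDist_map hm 1 (D / D') (p.2 - D / D' * p'.2) (by norm_num) hl2 (by simp) p' q'
  have f1 : ((1 * p'.1, D / D' * p'.2 + (p.2 - D / D' * p'.2)) : ℝ × ℝ) = p :=
    Prod.ext (by simp [hp1]) (by simp)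
  have f2 : ((1 * q'.1, D / D' * q'.2 + (p.2 - D / D' * p'.2)) : ℝ × ℝ) = q := by
    refine Prod.ext (by simp [hq1]) ?_
    have : D / D' * q'.2 = D / D' * p'.2 + D / D' * D' := by rw [hD']; ring
    simp only
    rw [this, hl]
    ring
  rwa [f1, f2] at this

theorem Geo.cyl_lt {m t p θ : ℝ → ℝ} {ν : ℝ} (hmc : Continuous m) (hm : ∀ t, 0 < m t)
    (g : Geo m ν t p θ) (hν : ν ≠ 0) {a : ℝ} (ha : 0 < a) (hθ : π < |θ a - θ 0|) :
    cylDist m (proj (t 0, θ 0)) (proj (t a, θ a)) < a := by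
  set D := θ a - θ 0 with hD
  set x := ((D : ℝ) : Real.Angle).toReal with hx
  have hx1 : |x| ≤ π := Real.Angle.abs_toReal_le_pi _
  have hD0 : D ≠ 0 := by
    intro h
    rw [h, abs_zero] at hθ
    linarith [pi_pos]
  set l := x / D with hl
  have hl1 : l ^ 2 < 1 := by
    rw [hl, div_pow, div_lt_one (by positivity)]
    exact sq_lt_sq.2 (hx1.trans_lt hθ)
  have hlD : l * D = x := by rw [hl]; field_simp
  have hpr : proj (t a, θ a) = proj (t a, θ 0 + l * (θ a - θ 0)) := by
    simp only [proj, Prod.mk.injEq, true_and]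
    rw [← hD, hlD, Real.Angle.coe_add, hx, Real.Angle.coe_toReal, ← Real.Angle.coe_add, hD]
    congr 1
    ring
  rw [hpr]
  refine (cylDist_le m _ _).trans_lt ?_
  have hc := g.curve_c1 hmc hm
  have hct : ContDiff ℝ 1 t := hc.fst
  have hcθ : ContDiff ℝ 1 θ := hc.snd
  have hc' : ContDiff ℝ 1 (fun s => ((t s, θ 0 + l * (θ s - θ 0)) : ℝ × ℝ)) := by fun_prop
  refine (wDist_le (c := fun s => (t s, θ 0 + l * (θ s - θ 0))) ha.le hc' (by simp) rfl).trans_lt ?_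
  rw [wLength_eq]
  have hlt : ∀ s, spd m (fun s => (t s, θ 0 + l * (θ s - θ 0))) s < 1 := by
    intro s
    have d1 : deriv (fun u => t u) s = p s := (g.ht s).deriv
    have d2 : deriv (fun u => θ 0 + l * (θ u - θ 0)) s = l * (ν / m (t s) ^ 2) :=
      (((g.hθ s).sub_const (θ 0)).const_mul l).const_add (θ 0) |>.deriv
    unfold spd
    simp only [d1, d2]
    rw [Real.sqrt_lt' one_pos]
    have e := g.he s
    have hms := hm (t s)
    have e2 : m (t s) ^ 2 * (l * (ν / m (t s) ^ 2)) ^ 2 = l ^ 2 * (ν ^ 2 / m (t s) ^ 2) := by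
      field_simp
    rw [e2]
    have : 0 < ν ^ 2 / m (t s) ^ 2 := by positivity
    nlinarith
  have := intervalIntegral.integral_lt_integral_of_continuousOn_of_le_of_exists_lt
    (f := spd m (fun s => (t s, θ 0 + l * (θ s - θ 0)))) (g := fun _ => (1:ℝ)) ha
    (spd_cont hmc hc').continuousOn continuousOn_const (fun s _ => (hlt s).le)
    ⟨0, ⟨le_rfl, ha.le⟩, hlt 0⟩
  simpa using this

theorem cut_main {m : ℝ → ℝ} {t0 : ℝ} (h : MH m t0) {u : ℝ} (hu : u ≠ 0)
    (hcase : |u| < t0 → π ≤ phi m (m u)) :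
    cylCutLocus m (u, ((0:ℝ) : Real.Angle)) =
      {P : ℝ × Real.Angle | P.2 = ((π:ℝ) : Real.Angle)} := by
  -- minimality up to angle `π`
  have hmin : ∀ {ν : ℝ} {t p θ : ℝ → ℝ}, Geo m ν t p θ → t 0 = u → ∀ a, 0 ≤ a →
      |θ a - θ 0| ≤ π → cylDist m (proj (t 0, θ 0)) (proj (t a, θ a)) = a := by
    intro ν t p θ g e a ha hθ
    rw [cylDist_eq h.cont (by simpa using hθ)]
    exact g.core_abs h (by rwa [e]) (by rwa [e]) hθ ha
  ext ⟨t1, A⟩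
  constructor
  · rintro ⟨γ, a, ⟨γ', hγ', rfl⟩, hγ0, ha, hγa, hmn, hcut⟩
    obtain ⟨ν, g⟩ := Geo.of_isUnit h.pos hγ'
    simp only [proj, Prod.mk.injEq] at hγ0 hγa
    obtain ⟨e1, e2⟩ := hγ0
    obtain ⟨e3, e4⟩ := hγa
    have hν : ν ≠ 0 := by
      intro hν
      have hc : (γ' (a + 1)).2 = (γ' 0).2 := by
        have := is_const_of_deriv_eq_zero (f := fun s => (γ' s).2)
          (fun s => (g.hθ s).differentiableAt)
          (fun s => by rw [(g.hθ s).deriv, hν, zero_div]) (a + 1) 0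
        exact this
      exact hcut 1 one_pos (hmin g e1 (a + 1) (by linarith) (by
        simp only [hc, sub_self, abs_zero]; exact pi_pos.le))
    rcases lt_trichotomy |(γ' a).2 - (γ' 0).2| π with hlt | heq | hgt
    · exfalso
      have hcn : Continuous fun s => |(γ' s).2 - (γ' 0).2| :=
        (g.θcont.sub continuous_const).abs
      have ev := hcn.continuousAt.eventually_lt (continuousAt_const (x := a)) hlt
      obtain ⟨δ, hδ, hb⟩ := Metric.eventually_nhds_iff.1 ev
      have := hb (y := a + δ / 2) (by
        rw [Real.dist_eq, add_sub_cancel_left, abs_of_pos (by linarith)]; linarith)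
      exact hcut (δ / 2) (by linarith) (hmin g e1 (a + δ / 2) (by linarith) this.le)
    · show A = _
      rw [← e4]
      have hA : ((γ' a).2 : Real.Angle) = (((γ' a).2 - (γ' 0).2 : ℝ) : Real.Angle) := by
        rw [Real.Angle.coe_sub, e2]; simp
      rw [hA]
      rcases (abs_eq pi_pos.le).1 heq with k | k
      · rw [k]
      · rw [k, Real.Angle.coe_neg, Real.Angle.neg_coe_pi]
    · exfalso
      have := g.cyl_lt h.cont h.pos hν ha hgt
      exact this.ne hmn
  · intro hA
    have hA' : A = ((π:ℝ) : Real.Angle) := hA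
    subst hA'
    obtain ⟨ν, t, p, θ, h1, g, h2, h3, a, h4, h5, h6⟩ := shoot_abs h hu hcase t1
    refine ⟨fun s => proj (t s, θ s), a, ⟨_, g.isUnit h, rfl⟩, ?_, h4, ?_, ?_, ?_⟩
    · simp [proj, h2, h3]
    · simp [proj, h5, h6]
    · exact hmin g h2 a h4.le (by rw [h5, h3, sub_zero, abs_of_pos pi_pos])
    · intro ε hε hc
      have hlt := g.θmono h.pos h1 (show a < a + ε by linarith)
      have := g.cyl_lt h.cont h.pos h1.ne' (a := a + ε) (by linarith) (by
        rw [h3, sub_zero]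
        exact (h5.symm.trans_lt hlt).trans_le (le_abs_self _))
      exact this.ne hc

end

/-- Main theorem, case 2: let `q = (t(q), 0)` on the cylinder `M` and
suppose either `0 < |t(q)| < t₀` and `φ(m(t(q))) ≥ π`, or `|t(q)| ≥ t₀`
(with `t₀ = sup {t > 0 | m'(t) < 0}` finite).  Then the cut locus of `q` is exactly the
opposite meridian `θ⁻¹(π)`. -/
theorem stmt19 (m : ℝ → ℝ) (hm : ContDiff ℝ (⊤:ℕ∞) m) (hmpos : ∀ t, 0 < m t)
    (hmeven : ∀ t, m (-t) = m t)
    (hK0 : 0 < gaussK m 0) (hKdec : AntitoneOn (gaussK m) (Ici 0))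
    (hbdd : BddAbove {t : ℝ | 0 < t ∧ deriv m t < 0})
    (tq : ℝ)
    (hcase : (0 < |tq| ∧ |tq| < tZero m ∧ π ≤ phi m (m tq)) ∨ tZero m ≤ |tq|) :
    cylCutLocus m (tq, ((0:ℝ) : Real.Angle)) =
      {P : ℝ × Real.Angle | P.2 = ((π:ℝ) : Real.Angle)} := by
  have h := mh_of_hyp m hm hmpos hmeven hK0 hKdec hbdd
  have ht0 := h.t0pos
  apply cut_main h
  · intro e
    rw [e, abs_zero] at hcase
    rcases hcase with hc | hc
    · exact lt_irrefl _ hc.1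
    · linarith
  · intro hlt
    rcases hcase with hc | hc
    · exact hc.2.2
    · linarith
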